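/- arXiv:0909.3989 — 7 statements merged into one kernel-verified Lean document; each statement's English description precedes it below -/
import Mathlib

section
/- Let m ≥ 1 and let G be a subgroup of GL_m(ℚ). Then G is finite if and only if both of the following hold: (i) there exists a symmetric positive definite matrix F ∈ ℚ^{m×m} with g·F·gᵀ = F for all g ∈ G, and (ii) there exists a full G-invariant lattice L ⊂ ℚ^{1×m}. -/
open Matrix
open scoped MatrixGroups

/-- A symmetric positive definite rational matrix. -/
def IsPosDefForm {m : ℕ} (F : Matrix (Fin m) (Fin m) ℚ) : Prop :=
  Fᵀ = F ∧ ∀ v : Fin m → ℚ, v ≠ 0 → 0 < v ⬝ᵥ F.mulVec v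

/-- `F` is a `G`-invariant form: `g * F * gᵀ = F` for all `g ∈ G`. -/
def IsInvariantForm {m : ℕ} (G : Subgroup (GL (Fin m) ℚ)) (F : Matrix (Fin m) (Fin m) ℚ) : Prop :=
  ∀ g ∈ G, (g : Matrix (Fin m) (Fin m) ℚ) * F * (g : Matrix (Fin m) (Fin m) ℚ)ᵀ = F

/-- A full `G`-invariant lattice in the row space `ℚ^{1×m}`: a finitely generated
`ℤ`-submodule that spans `ℚ^{1×m}` over `ℚ` and satisfies `L·g = L` for all `g ∈ G`. -/
def IsFullInvariantLattice {m : ℕ} (G : Subgroup (GL (Fin m) ℚ))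
    (L : Submodule ℤ (Fin m → ℚ)) : Prop :=
  L.FG ∧ Submodule.span ℚ (L : Set (Fin m → ℚ)) = ⊤ ∧
    ∀ g ∈ G, ∀ v ∈ L, v ᵥ* (g : Matrix (Fin m) (Fin m) ℚ) ∈ L

/-- A finitely generated `ℤ`-submodule of `ℚ` has only finitely many elements of bounded size. -/
theorem Submodule.FG.finite_setOf_abs_le {M : Submodule ℤ ℚ} (hM : M.FG) (C : ℚ) :
    {x : ℚ | x ∈ M ∧ |x| ≤ C}.Finite := by
  obtain ⟨S, rfl⟩ := hM
  obtain ⟨d, hd⟩ := IsLocalization.exist_integer_multiples_of_finset (nonZeroDivisors ℤ) S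
  have hd0 : ((d : ℤ) : ℚ) ≠ 0 := by exact_mod_cast nonZeroDivisors.coe_ne_zero d
  have hint : ∀ x ∈ Submodule.span ℤ (S : Set ℚ), ∃ n : ℤ, (n : ℚ) = (d : ℤ) * x := by
    intro x hx
    induction hx using Submodule.span_induction with
    | mem x hx =>
      obtain ⟨n, hn⟩ := hd x hx
      exact ⟨n, by simpa using hn⟩
    | zero => exact ⟨0, by simp⟩
    | add x y _ _ hx hy =>
      obtain ⟨a, ha⟩ := hx
      obtain ⟨b, hb⟩ := hy
      exact ⟨a + b, by push_cast; rw [ha, hb]; ring⟩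
    | smul k x _ hx =>
      obtain ⟨a, ha⟩ := hx
      exact ⟨k * a, by push_cast; rw [ha, zsmul_eq_mul]; ring⟩
  refine ((Set.finite_Icc (-⌈|((d : ℤ) : ℚ)| * C⌉) ⌈|((d : ℤ) : ℚ)| * C⌉).image
    (fun n : ℤ => (n : ℚ) / (d : ℤ))).subset ?_
  rintro x ⟨hx, hxC⟩
  obtain ⟨n, hn⟩ := hint x hx
  refine ⟨n, ?_, by simp only [hn]; field_simp⟩
  have h : |(n : ℚ)| ≤ |((d : ℤ) : ℚ)| * C := by
    rw [hn, abs_mul]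
    gcongr
  have h' : ((|n| : ℤ) : ℚ) ≤ (⌈|((d : ℤ) : ℚ)| * C⌉ : ℤ) := by
    push_cast
    exact h.trans (Int.le_ceil _)
  exact abs_le.mp (by exact_mod_cast h')

/-- The sum of `g * gᵀ` over a finite matrix group is an invariant positive definite form. -/
theorem exists_isPosDefForm_isInvariantForm {m : ℕ} {G : Subgroup (GL (Fin m) ℚ)}
    (hG : (G : Set (GL (Fin m) ℚ)).Finite) :
    ∃ F : Matrix (Fin m) (Fin m) ℚ, IsPosDefForm F ∧ IsInvariantForm G F := by
  refine ⟨∑ g ∈ hG.toFinset, (g : Matrix (Fin m) (Fin m) ℚ) * (g : Matrix (Fin m) (Fin m) ℚ)ᵀ,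
    ⟨?_, ?_⟩, ?_⟩
  · simp [transpose_sum, transpose_mul]
  · intro v hv
    have key : ∀ g : GL (Fin m) ℚ,
        v ⬝ᵥ ((g : Matrix (Fin m) (Fin m) ℚ) * (g : Matrix (Fin m) (Fin m) ℚ)ᵀ) *ᵥ v =
          (v ᵥ* (g : Matrix (Fin m) (Fin m) ℚ)) ⬝ᵥ (v ᵥ* (g : Matrix (Fin m) (Fin m) ℚ)) := by
      intro g
      rw [← mulVec_mulVec, dotProduct_mulVec, mulVec_transpose]
    rw [sum_mulVec, dotProduct_sum]
    refine Finset.sum_pos' (fun g _ => ?_) ⟨1, by simp, ?_⟩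
    · rw [key]
      exact Finset.sum_nonneg fun i _ => mul_self_nonneg _
    · rw [key]
      simp only [Units.val_one, vecMul_one]
      exact lt_of_le_of_ne (Finset.sum_nonneg fun i _ => mul_self_nonneg _)
        fun h => hv (dotProduct_self_eq_zero.mp h.symm)
  · intro h hh
    rw [Finset.mul_sum, Finset.sum_mul]
    refine Finset.sum_equiv (Equiv.mulLeft h) (fun g => ?_) (fun g _ => ?_)
    · simp [G.mul_mem_cancel_left hh]
    · simp [transpose_mul, Matrix.mul_assoc]

/-- The lattice generated by the rows of the elements of a finite matrix group is invariant. -/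
theorem exists_isFullInvariantLattice {m : ℕ} {G : Subgroup (GL (Fin m) ℚ)}
    (hG : (G : Set (GL (Fin m) ℚ)).Finite) :
    ∃ L : Submodule ℤ (Fin m → ℚ), IsFullInvariantLattice G L := by
  let S : Set (Fin m → ℚ) := Set.image2
    (fun (g : GL (Fin m) ℚ) (i : Fin m) => (g : Matrix (Fin m) (Fin m) ℚ) i) G Set.univ
  refine ⟨Submodule.span ℤ S, Submodule.fg_span (hG.image2 _ Set.finite_univ), ?_, ?_⟩
  · rw [Submodule.span_span_of_tower, eq_top_iff, ← (Pi.basisFun ℚ (Fin m)).span_eq]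
    refine Submodule.span_mono ?_
    rintro _ ⟨i, rfl⟩
    refine ⟨1, G.one_mem, i, trivial, ?_⟩
    ext j
    simp [Matrix.one_apply, Pi.single_apply, eq_comm]
  · intro h hh v hv
    induction hv using Submodule.span_induction with
    | mem v hv =>
      obtain ⟨g, hg, i, -, rfl⟩ := hv
      exact Submodule.subset_span ⟨g * h, G.mul_mem hg hh, i, trivial, by
        simp [Matrix.mul_apply_eq_vecMul]⟩
    | zero => simp
    | add v w _ _ hv hw => rw [add_vecMul]; exact add_mem hv hw
    | smul k v _ hv => rw [smul_vecMul]; exact Submodule.smul_mem _ _ hv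

/-- A bound of arithmetic–geometric mean type for a positive definite form. -/
theorem IsPosDefForm.two_mul_abs_le {m : ℕ} {F : Matrix (Fin m) (Fin m) ℚ} (hF : IsPosDefForm F)
    (v w : Fin m → ℚ) : 2 * |v ⬝ᵥ F *ᵥ w| ≤ v ⬝ᵥ F *ᵥ v + w ⬝ᵥ F *ᵥ w := by
  have hnonneg : ∀ u : Fin m → ℚ, 0 ≤ u ⬝ᵥ F *ᵥ u := fun u => by
    rcases eq_or_ne u 0 with rfl | hu
    · simp
    · exact (hF.2 u hu).le
  have hsymm : w ⬝ᵥ F *ᵥ v = v ⬝ᵥ F *ᵥ w := by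
    rw [dotProduct_mulVec, dotProduct_comm, ← mulVec_transpose, hF.1]
  have h₁ := hnonneg (v + w)
  have h₂ := hnonneg (v - w)
  simp only [mulVec_add, mulVec_sub, add_dotProduct, sub_dotProduct, dotProduct_add,
    dotProduct_sub, hsymm] at h₁ h₂
  rcases abs_cases (v ⬝ᵥ F *ᵥ w) with h | h <;> linarith

/-- A vector orthogonal to a spanning set with respect to a positive definite form vanishes. -/
theorem IsPosDefForm.eq_zero_of_span_eq_top {m : ℕ} {F : Matrix (Fin m) (Fin m) ℚ}
    (hF : IsPosDefForm F) {S : Set (Fin m → ℚ)} (hS : Submodule.span ℚ S = ⊤)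
    {v : Fin m → ℚ} (hv : ∀ s ∈ S, v ⬝ᵥ F *ᵥ s = 0) : v = 0 := by
  by_contra hne
  have h : ∀ u ∈ Submodule.span ℚ S, v ⬝ᵥ F *ᵥ u = 0 := by
    intro u hu
    induction hu using Submodule.span_induction with
    | mem u hu => exact hv u hu
    | zero => simp
    | add u w _ _ hu hw => rw [mulVec_add, dotProduct_add, hu, hw, add_zero]
    | smul k u _ hu => rw [mulVec_smul, dotProduct_smul, hu, smul_zero]
  exact (hF.2 v hne).ne' (h v (hS ▸ Submodule.mem_top))

/-- A matrix group preserving a positive definite form and a full lattice is finite. -/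
theorem finite_of_isInvariantForm_of_isFullInvariantLattice {m : ℕ}
    {G : Subgroup (GL (Fin m) ℚ)} {F : Matrix (Fin m) (Fin m) ℚ} (hF : IsPosDefForm F)
    (hGF : IsInvariantForm G F) {L : Submodule ℤ (Fin m → ℚ)} (hL : IsFullInvariantLattice G L) :
    (G : Set (GL (Fin m) ℚ)).Finite := by
  obtain ⟨hfg, htop, hGL⟩ := hL
  obtain ⟨S, hS⟩ := id hfg
  have hSL : ∀ s ∈ S, s ∈ L := fun s hs => hS ▸ Submodule.subset_span hs
  have hStop : Submodule.span ℚ (S : Set (Fin m → ℚ)) = ⊤ := by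
    rw [← htop, ← hS, Submodule.span_span_of_tower]
  let φ : (Fin m → ℚ) → (Fin m → ℚ) →ₗ[ℤ] ℚ := fun t =>
    { toFun := fun v => v ⬝ᵥ F *ᵥ t
      map_add' := fun v w => add_dotProduct v w _
      map_smul' := fun k v => smul_dotProduct k v _ }
  let C : S → S → ℚ := fun s t => ((s : Fin m → ℚ) ⬝ᵥ F *ᵥ s + (t : Fin m → ℚ) ⬝ᵥ F *ᵥ t) / 2
  have hfin : (Set.univ.pi fun s : S => Set.univ.pi fun t : S =>
      {x : ℚ | x ∈ L.map (φ t) ∧ |x| ≤ C s t}).Finite :=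
    Set.Finite.pi fun s => Set.Finite.pi fun t => (hfg.map (φ t)).finite_setOf_abs_le _
  refine Set.Finite.of_injOn (f := fun (g : GL (Fin m) ℚ) (s t : S) =>
    ((s : Fin m → ℚ) ᵥ* (g : Matrix (Fin m) (Fin m) ℚ)) ⬝ᵥ F *ᵥ (t : Fin m → ℚ)) ?_ ?_ hfin
  · intro g hg s _ t _
    refine ⟨⟨_, hGL g hg s (hSL s s.2), rfl⟩, ?_⟩
    have h := hF.two_mul_abs_le ((s : Fin m → ℚ) ᵥ* (g : Matrix (Fin m) (Fin m) ℚ)) t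
    have hinv : ((s : Fin m → ℚ) ᵥ* (g : Matrix (Fin m) (Fin m) ℚ)) ⬝ᵥ
        F *ᵥ ((s : Fin m → ℚ) ᵥ* (g : Matrix (Fin m) (Fin m) ℚ)) =
        (s : Fin m → ℚ) ⬝ᵥ F *ᵥ s := by
      conv_rhs => rw [← hGF g hg]
      rw [← mulVec_mulVec, ← mulVec_mulVec, mulVec_transpose, dotProduct_mulVec (s : Fin m → ℚ)]
    rw [hinv] at h
    simp only [C]
    linarith
  · intro g _ h _ hgh
    have hrow : ∀ s ∈ S, s ᵥ* (g : Matrix (Fin m) (Fin m) ℚ) =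
        s ᵥ* (h : Matrix (Fin m) (Fin m) ℚ) := by
      intro s hs
      refine sub_eq_zero.mp (hF.eq_zero_of_span_eq_top hStop fun t ht => ?_)
      rw [sub_dotProduct, sub_eq_zero]
      exact congrFun (congrFun hgh ⟨s, hs⟩) ⟨t, ht⟩
    have hlin : (g : Matrix (Fin m) (Fin m) ℚ).vecMulLinear =
        (h : Matrix (Fin m) (Fin m) ℚ).vecMulLinear :=
      LinearMap.ext_on hStop hrow
    refine Units.ext (Matrix.ext fun i j => ?_)
    simpa using congrFun (LinearMap.congr_fun hlin (Pi.single i 1)) j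

/-- A subgroup `G ≤ GL_m(ℚ)` is finite if and only if it fixes a symmetric positive definite
form and a full lattice. -/
theorem finite_iff_invariant_form_and_lattice {m : ℕ} (hm : 1 ≤ m)
    (G : Subgroup (GL (Fin m) ℚ)) :
    (G : Set (GL (Fin m) ℚ)).Finite ↔
      ((∃ F : Matrix (Fin m) (Fin m) ℚ, IsPosDefForm F ∧ IsInvariantForm G F) ∧
       (∃ L : Submodule ℤ (Fin m → ℚ), IsFullInvariantLattice G L)) := by
  constructor
  · exact fun hG => ⟨exists_isPosDefForm_isInvariantForm hG, exists_isFullInvariantLattice hG⟩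
  · rintro ⟨⟨F, hF, hGF⟩, L, hL⟩
    exact finite_of_isInvariantForm_of_isFullInvariantLattice hF hGF hL
end

section
/- Let g = ((0,1),(−1,0)) ∈ GL_2(ℚ), let G = ⟨g⟩, and for a nonzero rational a let h_a = diag(1, a). Then: (i) for every nonzero a ∈ ℚ, the conjugate group h_a⁻¹·G·h_a is contained in Sp_2(ℚ); and (ii) for nonzero a, b ∈ ℚ, the groups h_a⁻¹·G·h_a and h_b⁻¹·G·h_b are conjugate by an element of Sp_2(ℚ) if and only if |a·b| is a norm from ℚ(i), i.e., if and only if there exist x, y ∈ ℚ with |a·b| = x² + y². -/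
open Matrix
open scoped MatrixGroups

/-- The matrix `g = ((0,1),(−1,0))`, which is also the Gram matrix `J` of the standard
symplectic form on `ℚ²`. -/
def gMat : Matrix (Fin 2) (Fin 2) ℚ := !![0, 1; -1, 0]

/-- `g = ((0,1),(−1,0))` as an element of `GL_2(ℚ)`. -/
def gU : GL (Fin 2) ℚ :=
  ⟨gMat, -gMat, by
    ext i j
    fin_cases i <;> fin_cases j <;>
      simp [gMat, Matrix.mul_apply, Fin.sum_univ_two, Matrix.one_apply], by
    ext i j
    fin_cases i <;> fin_cases j <;>
      simp [gMat, Matrix.mul_apply, Fin.sum_univ_two, Matrix.one_apply]⟩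

/-- `h_a = diag(1, a)` as an element of `GL_2(ℚ)`, for `a ≠ 0`. -/
def hU (a : ℚ) (ha : a ≠ 0) : GL (Fin 2) ℚ :=
  ⟨!![1, 0; 0, a], !![1, 0; 0, a⁻¹], by
    ext i j
    fin_cases i <;> fin_cases j <;>
      simp [Matrix.mul_apply, Fin.sum_univ_two, Matrix.one_apply, mul_inv_cancel₀ ha], by
    ext i j
    fin_cases i <;> fin_cases j <;>
      simp [Matrix.mul_apply, Fin.sum_univ_two, Matrix.one_apply, inv_mul_cancel₀ ha]⟩

/-- `Sp_2(ℚ)`, as a set of elements of `GL_2(ℚ)`. -/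
def Sp2 : Set (GL (Fin 2) ℚ) :=
  {s | (s : Matrix (Fin 2) (Fin 2) ℚ) * gMat * (s : Matrix (Fin 2) (Fin 2) ℚ)ᵀ = gMat}

/-- The conjugate group `h_a⁻¹ ⟨g⟩ h_a`. -/
def Gconj (a : ℚ) (ha : a ≠ 0) : Subgroup (GL (Fin 2) ℚ) :=
  Subgroup.zpowers ((hU a ha)⁻¹ * gU * hU a ha)

theorem mem_zpowers_of_mul_self_eq_neg_one {u x : GL (Fin 2) ℚ} (hu : u * u = -1)
    (hx : x ∈ Subgroup.zpowers u) : x = 1 ∨ x = -1 ∨ x = u ∨ x = -u := by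
  have hinv : u⁻¹ = -u := by
    rw [inv_eq_iff_mul_eq_one, mul_neg, hu, neg_neg]
  obtain ⟨n, rfl⟩ := Subgroup.mem_zpowers_iff.mp hx
  clear hx
  induction n using Int.induction_on with
  | zero => simp
  | succ n ih =>
    rw [_root_.zpow_add_one]
    rcases ih with h | h | h | h <;> rw [h] <;> simp [hu]
  | pred n ih =>
    rw [_root_.zpow_sub_one, hinv]
    rcases ih with h | h | h | h <;> rw [h] <;> simp [hu]

theorem mem_Sp2_iff (s : GL (Fin 2) ℚ) :
    s ∈ Sp2 ↔ (s : Matrix (Fin 2) (Fin 2) ℚ).det = 1 := by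
  have key : (s : Matrix (Fin 2) (Fin 2) ℚ) * gMat * (s : Matrix (Fin 2) (Fin 2) ℚ)ᵀ =
      (s : Matrix (Fin 2) (Fin 2) ℚ).det • gMat := by
    ext i j
    fin_cases i <;> fin_cases j <;>
      simp [gMat, Matrix.mul_apply, Fin.sum_univ_two, Matrix.det_fin_two] <;> ring
  simp only [Sp2, Set.mem_ofPred_eq, key]
  refine ⟨fun h => ?_, fun h => by rw [h, one_smul]⟩
  simpa [gMat] using congrFun (congrFun h 0) 1

theorem gU_mul_self : gU * gU = -1 := by
  ext i j
  fin_cases i <;> fin_cases j <;>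
    simp [gU, gMat, Matrix.mul_apply, Fin.sum_univ_two]

/-- The generator `h_a⁻¹ g h_a` of `Gconj a`. -/
def gConjU (a : ℚ) (ha : a ≠ 0) : GL (Fin 2) ℚ := (hU a ha)⁻¹ * gU * hU a ha

theorem coe_gConjU (a : ℚ) (ha : a ≠ 0) :
    (gConjU a ha : Matrix (Fin 2) (Fin 2) ℚ) = !![0, a; -a⁻¹, 0] := by
  change !![1, 0; 0, a⁻¹] * gMat * !![1, 0; 0, a] = _
  simp [gMat]

theorem gConjU_neg (a : ℚ) (ha : a ≠ 0) : gConjU (-a) (neg_ne_zero.mpr ha) = -gConjU a ha := by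
  apply Units.ext
  rw [Units.val_neg, coe_gConjU, coe_gConjU]
  simp [inv_neg]

theorem gConjU_mul_self (a : ℚ) (ha : a ≠ 0) : gConjU a ha * gConjU a ha = -1 := by
  apply Units.ext
  rw [Units.val_mul, coe_gConjU]
  ext i j
  fin_cases i <;> fin_cases j <;> simp [ha]

theorem gConjU_ne_one (a : ℚ) (ha : a ≠ 0) : gConjU a ha ≠ 1 := fun h => by
  have h00 : (gConjU a ha).val 0 0 = 0 := by simp [coe_gConjU]
  rw [h] at h00
  simp at h00

theorem gConjU_ne_neg_one (a : ℚ) (ha : a ≠ 0) : gConjU a ha ≠ -1 := fun h => by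
  have h00 : (gConjU a ha).val 0 0 = 0 := by simp [coe_gConjU]
  rw [h] at h00
  simp at h00

theorem zpowers_gConjU_neg (a : ℚ) (ha : a ≠ 0) :
    Subgroup.zpowers (-gConjU a ha) = Subgroup.zpowers (gConjU a ha) := by
  have hinv : (gConjU a ha)⁻¹ = -gConjU a ha := by
    rw [inv_eq_iff_mul_eq_one, mul_neg, gConjU_mul_self, neg_neg]
  rw [← hinv, Subgroup.zpowers_inv]

theorem map_conj_Gconj (s : GL (Fin 2) ℚ) (a : ℚ) (ha : a ≠ 0) :
    Subgroup.map (MulAut.conj s).toMonoidHom (Gconj a ha) =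
      Subgroup.zpowers (s * gConjU a ha * s⁻¹) := by
  rw [Gconj, MonoidHom.map_zpowers]
  rfl

theorem exists_conj_gConjU_iff (a c : ℚ) (ha : a ≠ 0) (hc : c ≠ 0) :
    (∃ s ∈ Sp2, s * gConjU a ha * s⁻¹ = gConjU c hc) ↔ ∃ x y : ℚ, a * c = x ^ 2 + y ^ 2 := by
  constructor
  · rintro ⟨s, hs, h⟩
    rw [mem_Sp2_iff, Matrix.det_fin_two] at hs
    have h' := congrArg Units.val (mul_inv_eq_iff_eq_mul.mp h)
    rw [Units.val_mul, Units.val_mul, coe_gConjU, coe_gConjU] at h'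
    have h00 := congrFun (congrFun h' 0) 0
    have h01 := congrFun (congrFun h' 0) 1
    simp [Matrix.mul_apply, Fin.sum_univ_two] at h00 h01
    refine ⟨a * s.val 0 0, a * c * s.val 1 0, ?_⟩
    have hq : s.val 0 1 = -(a * c * s.val 1 0) := by
      field_simp at h00
      linarith
    rw [hq] at hs
    linear_combination (-a * c) * hs - a * s.val 0 0 * h01
  · rintro ⟨x, y, h⟩
    have hdet : !![x / a, -y; y / (a * c), x / c].det = 1 := by
      rw [Matrix.det_fin_two_of]
      field_simp
      linarith
    let s : GL (Fin 2) ℚ := Matrix.GeneralLinearGroup.mkOfDetNeZero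
      !![x / a, -y; y / (a * c), x / c] (by rw [hdet]; exact one_ne_zero)
    refine ⟨s, (mem_Sp2_iff s).mpr hdet, mul_inv_eq_iff_eq_mul.mpr (Units.ext ?_)⟩
    rw [Units.val_mul, Units.val_mul, coe_gConjU, coe_gConjU]
    change !![x / a, -y; y / (a * c), x / c] * _ = _ * !![x / a, -y; y / (a * c), x / c]
    ext i j
    fin_cases i <;> fin_cases j <;> simp <;> field_simp

theorem exists_map_conj_Gconj_iff (a b : ℚ) (ha : a ≠ 0) (hb : b ≠ 0) :
    (∃ s ∈ Sp2, Subgroup.map (MulAut.conj s).toMonoidHom (Gconj a ha) = Gconj b hb) ↔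
      (∃ s ∈ Sp2, s * gConjU a ha * s⁻¹ = gConjU b hb) ∨
        ∃ s ∈ Sp2, s * gConjU a ha * s⁻¹ = gConjU (-b) (neg_ne_zero.mpr hb) := by
  simp only [map_conj_Gconj]
  rw [gConjU_neg b hb]
  constructor
  · rintro ⟨s, hs, h⟩
    have hmem : s * gConjU a ha * s⁻¹ ∈ Subgroup.zpowers (gConjU b hb) := by
      change _ ∈ Gconj b hb
      rw [← h]
      exact Subgroup.mem_zpowers _
    rcases mem_zpowers_of_mul_self_eq_neg_one (gConjU_mul_self b hb) hmem with h | h | h | h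
    · exact absurd (by simpa using h) (gConjU_ne_one a ha)
    · rw [mul_inv_eq_iff_eq_mul, neg_one_mul, ← mul_neg_one] at h
      exact absurd (mul_left_cancel h) (gConjU_ne_neg_one a ha)
    · exact Or.inl ⟨s, hs, h⟩
    · exact Or.inr ⟨s, hs, h⟩
  · rintro (⟨s, hs, h⟩ | ⟨s, hs, h⟩)
    · exact ⟨s, hs, by rw [h]; rfl⟩
    · exact ⟨s, hs, by rw [h, zpowers_gConjU_neg]; rfl⟩

/-- (i) each `h_a⁻¹⟨g⟩h_a` lies in `Sp_2(ℚ)`; (ii) `h_a⁻¹⟨g⟩h_a` and `h_b⁻¹⟨g⟩h_b` are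
conjugate by an element of `Sp_2(ℚ)` if and only if `|a·b|` is a sum of two rational
squares (i.e. a norm from `ℚ(i)`). -/
theorem conj_classes_in_Sp2 :
    (∀ (a : ℚ) (ha : a ≠ 0), ∀ x ∈ Subgroup.zpowers gU,
      (hU a ha)⁻¹ * x * hU a ha ∈ Sp2) ∧
    (∀ (a b : ℚ) (ha : a ≠ 0) (hb : b ≠ 0),
      (∃ s ∈ Sp2, Subgroup.map (MulAut.conj s).toMonoidHom (Gconj a ha) = Gconj b hb) ↔
        ∃ x y : ℚ, |a * b| = x ^ 2 + y ^ 2) := by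
  refine ⟨fun a ha x hx => ?_, fun a b ha hb => ?_⟩
  · rw [mem_Sp2_iff]
    have hx' : (x : Matrix (Fin 2) (Fin 2) ℚ).det = 1 := by
      rcases mem_zpowers_of_mul_self_eq_neg_one gU_mul_self hx with rfl | rfl | rfl | rfl <;>
        simp [gU, gMat, Matrix.det_fin_two]
    have hcomm : Matrix.GeneralLinearGroup.det ((hU a ha)⁻¹ * x * hU a ha) =
        Matrix.GeneralLinearGroup.det x := by
      rw [map_mul, map_mul, map_inv, mul_right_comm, inv_mul_cancel, one_mul]
    exact (congrArg Units.val hcomm).trans hx'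
  · rw [exists_map_conj_Gconj_iff, exists_conj_gConjU_iff, exists_conj_gConjU_iff]
    constructor
    · rintro (⟨x, y, h⟩ | ⟨x, y, h⟩)
      · exact ⟨x, y, by rw [abs_of_nonneg (by rw [h]; positivity), h]⟩
      · refine ⟨x, y, ?_⟩
        rw [mul_neg] at h
        rw [← abs_neg, abs_of_nonneg (by rw [h]; positivity), h]
    · rintro ⟨x, y, h⟩
      rcases abs_choice (a * b) with h' | h'
      · exact Or.inl ⟨x, y, h'.symm.trans h⟩
      · exact Or.inr ⟨x, y, by rw [mul_neg, ← h', h]⟩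
end

section
/- Let G ≤ GL_{2n}(ℚ) be a maximal finite symplectic subgroup. Then the natural ℚ[G]-module ℚ^{1×2n} is multiplicity-free, i.e., it is a direct sum of pairwise nonisomorphic irreducible ℚ[G]-modules; equivalently, any two simple ℚ[G]-submodules of ℚ^{1×2n} that are isomorphic as ℚ[G]-modules are equal. -/
open Matrix
open scoped MatrixGroups

/-- `G ≤ GL_m(ℚ)` is symplectic if it fixes some invertible skew-symmetric form. -/
def IsSymplecticGroup {m : ℕ} (G : Subgroup (GL (Fin m) ℚ)) : Prop :=
  ∃ A : Matrix (Fin m) (Fin m) ℚ, Aᵀ = -A ∧ IsUnit A ∧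
    ∀ g ∈ G, (g : Matrix (Fin m) (Fin m) ℚ) * A * (g : Matrix (Fin m) (Fin m) ℚ)ᵀ = A

/-- A `ℚ`-subspace of the natural (right) module `ℚ^{1×m}` invariant under `G`,
i.e. a `ℚ[G]`-submodule. -/
def IsInvariantSubspace {m : ℕ} (G : Subgroup (GL (Fin m) ℚ))
    (W : Submodule ℚ (Fin m → ℚ)) : Prop :=
  ∀ g ∈ G, ∀ v ∈ W, v ᵥ* (g : Matrix (Fin m) (Fin m) ℚ) ∈ W

/-- A simple (irreducible) `ℚ[G]`-submodule of `ℚ^{1×m}`. -/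
def IsSimpleSubmoduleFor {m : ℕ} (G : Subgroup (GL (Fin m) ℚ))
    (W : Submodule ℚ (Fin m → ℚ)) : Prop :=
  W ≠ ⊥ ∧ IsInvariantSubspace G W ∧
    ∀ U : Submodule ℚ (Fin m → ℚ), U ≤ W → IsInvariantSubspace G U → U = ⊥ ∨ U = W

/-- Two `ℚ[G]`-submodules of `ℚ^{1×m}` are isomorphic as `ℚ[G]`-modules: there is a
`ℚ`-linear equivalence commuting with the (right) `G`-action. -/
def IsModuleIsoFor {m : ℕ} (G : Subgroup (GL (Fin m) ℚ))
    (W W' : Submodule ℚ (Fin m → ℚ)) : Prop :=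
  ∃ e : W ≃ₗ[ℚ] W', ∀ g ∈ G, ∀ w w' : W,
    (w' : Fin m → ℚ) = (w : Fin m → ℚ) ᵥ* (g : Matrix (Fin m) (Fin m) ℚ) →
      ((e w' : W') : Fin m → ℚ) = ((e w : W') : Fin m → ℚ) ᵥ* (g : Matrix (Fin m) (Fin m) ℚ)

section

variable {K V M Γ : Type*} [Field K] [AddCommGroup V] [Module K V] [FiniteDimensional K V]
  [AddCommGroup M] [Module K M] [Group Γ]

/-- A representation preserving the form `A` is *saturated* if it hits every equivariant isometry
`h` of `A` with `h ^ 4 = 1`. -/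
def Representation.IsSaturated (ρ : Representation K Γ V) (A : LinearMap.BilinForm K V) : Prop :=
  ∀ h : V →ₗ[K] V, h ^ 4 = 1 → (∀ g x, h (ρ g x) = ρ g (h x)) →
    (∀ x y, A (h x) (h y) = A x y) → ∃ g, ρ g = h

/-- If a parametrized subspace `ι : M → V` on which `A` is nondegenerate carries an equivariant
isometry `φ` with `φ ^ 4 = 1`, then some group element acts as `φ` on the range of `ι` and trivially
on a complement. -/
theorem Representation.IsSaturated.exists_extension {ρ : Representation K Γ V}
    {A : LinearMap.BilinForm K V} (hsat : ρ.IsSaturated A) (hA : A.IsRefl)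
    (hinv : ∀ g x y, A (ρ g x) (ρ g y) = A x y) (ι : M →ₗ[K] V)
    (hι : ∀ a, (∀ b, A (ι a) (ι b) = 0) → a = 0) (φ : M →ₗ[K] M) (hφ : φ ^ 4 = 1)
    (hφA : ∀ a b, A (ι (φ a)) (ι (φ b)) = A (ι a) (ι b))
    (hφρ : ∀ g a, ∃ b, ι b = ρ g (ι a) ∧ ι (φ b) = ρ g (ι (φ a))) :
    ∃ N : Submodule K V, IsCompl ι.range N ∧ ∃ g, (∀ a, ρ g (ι a) = ι (φ a)) ∧
      ∀ x ∈ N, ρ g x = x := by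
  have hinj : Function.Injective ι := by
    rw [injective_iff_map_eq_zero]
    exact fun a ha => hι a (by simp [ha])
  have hnd : (A.restrict ι.range).Nondegenerate := by
    have hsep : ∀ x : ι.range, (∀ y : ι.range, A x y = 0) → x = 0 := by
      rintro ⟨_, a, rfl⟩ hx
      have : a = 0 := hι a fun b => hx ⟨ι b, b, rfl⟩
      simp [this]
    exact ⟨hsep, fun y hy => hsep y fun x => hA _ _ (hy x)⟩
  have hc := LinearMap.BilinForm.isCompl_orthogonal_of_restrict_nondegenerate hA hnd
  set N := A.orthogonal ι.range
  have hort : ∀ a, ∀ x ∈ N, A (ι a) x = 0 := fun a x hx => hx _ ⟨a, rfl⟩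
  have hort' : ∀ a, ∀ x ∈ N, A x (ι a) = 0 := fun a x hx => hA _ _ (hort a x hx)
  have hNinv : ∀ g, ∀ x ∈ N, ρ g x ∈ N := by
    rintro g x hx _ ⟨a, rfl⟩
    obtain ⟨b, hb, -⟩ := hφρ g⁻¹ a
    have := hinv g (ι b) x
    rw [hb, Representation.self_inv_apply] at this
    change A (ι a) (ρ g x) = 0
    rw [this, ← hb]
    exact hort b x hx
  have hdec : ∀ x, ∃ a, ∃ u ∈ N, x = ι a + u := by
    intro x
    obtain ⟨_, ⟨a, rfl⟩, u, hu, rfl⟩ :=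
      Submodule.mem_sup.1 (hc.sup_eq_top ▸ Submodule.mem_top (x := x))
    exact ⟨a, u, hu, rfl⟩
  let h : V →ₗ[K] V := LinearMap.ofIsCompl hc
    (ι ∘ₗ φ ∘ₗ (LinearEquiv.ofInjective ι hinj).symm.toLinearMap) N.subtype
  have hhι : ∀ a, h (ι a) = ι (φ a) := by
    intro a
    have := LinearMap.ofIsCompl_apply_left hc
      (φ := ι ∘ₗ φ ∘ₗ (LinearEquiv.ofInjective ι hinj).symm.toLinearMap) (ψ := N.subtype)
      (LinearEquiv.ofInjective ι hinj a)
    simpa using this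
  have hhN : ∀ x ∈ N, h x = x := fun x hx => LinearMap.ofIsCompl_apply_right hc ⟨x, hx⟩
  have hcomm : ∀ g x, h (ρ g x) = ρ g (h x) := by
    intro g x
    obtain ⟨a, u, hu, rfl⟩ := hdec x
    obtain ⟨b, hb, hb'⟩ := hφρ g a
    simp only [map_add, ← hb, hhι, hhN u hu, hhN _ (hNinv g u hu), hb']
  have hpow : h ^ 4 = 1 := by
    ext x
    obtain ⟨a, u, hu, rfl⟩ := hdec x
    have := LinearMap.congr_fun hφ a
    simp only [pow_succ, pow_zero, one_mul, Module.End.mul_apply, Module.End.one_apply] at this ⊢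
    simp only [map_add, hhι, hhN u hu, this]
  have hiso : ∀ x y, A (h x) (h y) = A x y := by
    intro x y
    obtain ⟨a, u, hu, rfl⟩ := hdec x
    obtain ⟨b, v, hv, rfl⟩ := hdec y
    simp only [map_add, hhι, hhN u hu, hhN v hv, LinearMap.add_apply, hφA, hort _ _ hv,
      hort' _ _ hu]
  obtain ⟨g, hg⟩ := hsat h hpow hcomm hiso
  exact ⟨N, hc, g, by simpa [hg] using hhι, by simpa [hg] using hhN⟩

/-- If a copy `ι W` of the simple submodule `W` is not isotropic, then it is the only copy of
`W` in `V`. -/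
theorem Representation.IsSaturated.range_le [NeZero (2 : K)] {ρ : Representation K Γ V}
    {A : LinearMap.BilinForm K V} (hsat : ρ.IsSaturated A) (hA : A.IsRefl)
    (hinv : ∀ g x y, A (ρ g x) (ρ g y) = A x y) {W : Submodule K V}
    (hW : ∀ g, ∀ w ∈ W, ρ g w ∈ W)
    (hsimple : ∀ U ≤ W, (∀ g, ∀ u ∈ U, ρ g u ∈ U) → U = ⊥ ∨ U = W)
    (ι f : W →ₗ[K] V) (hι : ∀ g (w : W), ι ⟨ρ g w, hW g w w.2⟩ = ρ g (ι w))
    (hf : ∀ g (w : W), f ⟨ρ g w, hW g w w.2⟩ = ρ g (f w)) (hne : ∃ a b, A (ι a) (ι b) ≠ 0) :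
    f.range ≤ ι.range := by
  have hnd : ∀ a, (∀ b, A (ι a) (ι b) = 0) → a = 0 := by
    let U : Submodule K V := (LinearMap.ker (A.compl₁₂ ι ι)).map W.subtype
    have memU : ∀ w : W, (w : V) ∈ U ↔ ∀ b, A (ι w) (ι b) = 0 := by
      intro w
      simp [U, LinearMap.ext_iff]
    have hUW : U ≤ W := Submodule.map_subtype_le _ _
    have hU : ∀ g, ∀ u ∈ U, ρ g u ∈ U := by
      intro g u hu
      have hu' := (memU ⟨u, hUW hu⟩).1 hu
      refine (memU ⟨ρ g u, hW g u (hUW hu)⟩).2 fun b => ?_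
      have h2 := hinv g (ι ⟨u, hUW hu⟩) (ρ g⁻¹ (ι b))
      rw [Representation.self_inv_apply, ← hι g⁻¹ b, hu', ← hι] at h2
      exact h2
    rcases hsimple U hUW hU with h | h
    · intro a ha
      have := (memU a).2 ha
      simpa [h] using this
    · obtain ⟨a, b, hab⟩ := hne
      exact absurd ((memU a).1 (h.ge a.2) b) hab
  have hpow : (-1 : W →ₗ[K] W) ^ 4 = 1 := by
    ext
    simp [pow_succ]
  obtain ⟨N, hc, g, hgι, hgN⟩ := hsat.exists_extension hA hinv ι hnd (-1) hpow (by simp)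
    (fun g a => ⟨⟨ρ g a, hW g a a.2⟩, hι g a, by simp [hι]⟩)
  have hker : ∀ a : W, ρ g (f a) = - f a := by
    have hι_inj : Function.Injective ι := by
      rw [injective_iff_map_eq_zero]
      exact fun a ha => hnd a (by simp [ha])
    intro a
    have : (⟨ρ g a, hW g a a.2⟩ : W) = -a := hι_inj (by simp [hι, hgι])
    rw [← hf, this, map_neg]
  rintro _ ⟨a, rfl⟩
  obtain ⟨_, ⟨b, rfl⟩, u, hu, h⟩ :=
    Submodule.mem_sup.1 (hc.sup_eq_top ▸ Submodule.mem_top (x := f a))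
  have h1 := hker a
  rw [← h, map_add, hgι, hgN u hu, neg_add, LinearMap.neg_apply, Module.End.one_apply, map_neg,
    add_right_inj, eq_neg_iff_add_eq_zero, ← two_smul K] at h1
  have hu0 : u = 0 := (smul_eq_zero.1 h1).resolve_left two_ne_zero
  exact ⟨b, by rw [← h, hu0, add_zero]⟩

end

section

variable {K V Γ : Type*} [Field K] [LinearOrder K] [AddCommGroup V] [Module K V]
  [FiniteDimensional K V] [Group Γ]

/-- A positive definite invariant form `s` turns `A` into an equivariant endomorphism `P`
with `A x y = s (P x) y`. -/
theorem Representation.exists_adjoint_of_posDef {ρ : Representation K Γ V}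
    {A s : LinearMap.BilinForm K V} (hAsep : ∀ x, (∀ y, A x y = 0) → x = 0)
    (hinv : ∀ g x y, A (ρ g x) (ρ g y) = A x y) (hs : ∀ x, x ≠ 0 → 0 < s x x)
    (hsymm : ∀ x y, s x y = s y x) (hsinv : ∀ g x y, s (ρ g x) (ρ g y) = s x y) :
    ∃ P : V →ₗ[K] V, (∀ g x, P (ρ g x) = ρ g (P x)) ∧ (∀ x y, A x (P y) = A y (P x)) ∧
      ∀ x, x ≠ 0 → 0 < A x (P x) := by
  have hsep : ∀ x, (∀ y, s x y = 0) → x = 0 := fun x hx => by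
    by_contra h
    exact (hs x h).ne' (hx x)
  have hnd : s.Nondegenerate := ⟨hsep, fun y hy => hsep y fun x => by rw [hsymm, hy]⟩
  have hP : ∀ x y, s (A.symmCompOfNondegenerate s hnd x) y = A x y := fun x y =>
    LinearMap.BilinForm.symmCompOfNondegenerate_left_apply A hnd y x
  set P := A.symmCompOfNondegenerate s hnd
  refine ⟨P, fun g x => ?_, fun x y => ?_, fun x hx => ?_⟩
  · rw [← sub_eq_zero]
    refine hsep _ fun y => ?_
    have h1 := hinv g x (ρ g⁻¹ y)
    have h2 := hsinv g (P x) (ρ g⁻¹ y)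
    rw [Representation.self_inv_apply] at h1 h2
    rw [map_sub, LinearMap.sub_apply, hP, h1, h2, hP, sub_self]
  · rw [← hP, hsymm, hP]
  · rw [← hP]
    exact hs _ fun h => hx (hAsep x fun y => by rw [← hP, h, map_zero, LinearMap.zero_apply])

/-- If a representation is saturated for an alternating form admitting a positive equivariant
endomorphism `P`, then isomorphic simple subrepresentations are equal. -/
theorem Representation.IsSaturated.eq_of_equiv [IsStrictOrderedRing K] {ρ : Representation K Γ V}
    {A : LinearMap.BilinForm K V} (hsat : ρ.IsSaturated A) (hA : A.IsAlt)
    (hinv : ∀ g x y, A (ρ g x) (ρ g y) = A x y) {P : V →ₗ[K] V}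
    (hPρ : ∀ g x, P (ρ g x) = ρ g (P x)) (hPsymm : ∀ x y, A x (P y) = A y (P x))
    (hPpos : ∀ x, x ≠ 0 → 0 < A x (P x)) {W W' : Submodule K V} (hW : ∀ g, ∀ w ∈ W, ρ g w ∈ W)
    (hbot : W ≠ ⊥) (hsimple : ∀ U ≤ W, (∀ g, ∀ u ∈ U, ρ g u ∈ U) → U = ⊥ ∨ U = W)
    (e : W ≃ₗ[K] W') (he : ∀ g (w : W), (e ⟨ρ g w, hW g w w.2⟩ : V) = ρ g (e w)) : W = W' := by
  have unique : ∀ ι : W →ₗ[K] V, (∀ g (w : W), ι ⟨ρ g w, hW g w w.2⟩ = ρ g (ι w)) →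
      (∃ a b, A (ι a) (ι b) ≠ 0) → W = W' := by
    intro ι hι hne
    have h1 := hsat.range_le hA.isRefl hinv hW hsimple ι W.subtype hι (fun _ _ => rfl) hne
    have h2 := hsat.range_le hA.isRefl hinv hW hsimple ι (W'.subtype ∘ₗ e.toLinearMap) hι
      he hne
    rw [Submodule.range_subtype] at h1
    rw [LinearMap.range_comp, LinearEquiv.range, Submodule.map_top, Submodule.range_subtype] at h2
    have h3 : Module.finrank K ι.range ≤ Module.finrank K W := LinearMap.finrank_range_le ι
    exact (Submodule.eq_of_le_of_finrank_le h1 h3).trans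
      (Submodule.eq_of_le_of_finrank_le h2 (h3.trans e.finrank_eq.le)).symm
  by_cases h1 : ∃ a b : W, A a b ≠ 0
  · exact unique W.subtype (fun _ _ => rfl) h1
  by_cases h2 : ∃ a b : W, A (P a) (P b) ≠ 0
  · exact unique (P ∘ₗ W.subtype) (fun g w => hPρ g w) h2
  push Not at h1 h2
  exfalso
  let ι : W × W →ₗ[K] V := W.subtype.coprod (P ∘ₗ W.subtype)
  let J : W × W →ₗ[K] W × W := (-LinearMap.snd K W W).prod (LinearMap.fst K W W)
  have hι : ∀ a, ι a = a.1 + P a.2 := fun _ => rfl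
  have hJ : ∀ a, J a = (-a.2, a.1) := fun _ => rfl
  have hAι : ∀ a b : W × W, A (ι a) (ι b) = A (a.1 : V) (P b.2) - A (b.1 : V) (P a.2) := by
    intro a b
    have := hA.neg_eq (b.1 : V) (P a.2)
    simp only [hι, map_add, LinearMap.add_apply, h1, h2, ← this]
    ring
  have hnd : ∀ a, (∀ b, A (ι a) (ι b) = 0) → a = 0 := by
    intro a ha
    have h3 := ha (J a)
    rw [hAι, hJ] at h3
    simp only [NegMemClass.coe_neg, map_neg, LinearMap.neg_apply, sub_neg_eq_add] at h3
    have hnn : ∀ w : V, 0 ≤ A w (P w) := fun w => by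
      rcases eq_or_ne w 0 with rfl | h
      · simp
      · exact (hPpos w h).le
    have hz : ∀ w : W, A (w : V) (P w) = 0 → w = 0 := fun w hw => by
      by_contra h
      exact (hPpos w (by simpa using h)).ne' hw
    have h5 := hnn a.1
    have h6 := hnn a.2
    exact Prod.ext (hz _ (by linarith)) (hz _ (by linarith))
  have hpow : J ^ 4 = 1 := by
    ext a <;> simp [pow_succ, hJ]
  have hiso : ∀ a b, A (ι (J a)) (ι (J b)) = A (ι a) (ι b) := by
    intro a b
    rw [hAι, hAι, hJ, hJ]
    simp only [NegMemClass.coe_neg, map_neg, LinearMap.neg_apply]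
    rw [hPsymm a.2, hPsymm b.2]
    ring
  have hequiv : ∀ g a, ∃ b, ι b = ρ g (ι a) ∧ ι (J b) = ρ g (ι (J a)) := by
    intro g a
    refine ⟨(⟨ρ g a.1, hW g _ a.1.2⟩, ⟨ρ g a.2, hW g _ a.2.2⟩), ?_, ?_⟩
    · simp [hι, hPρ]
    · simp [hι, hJ, hPρ]
  obtain ⟨-, -, g, hg, -⟩ := hsat.exists_extension hA.isRefl hinv ι hnd J hpow hiso hequiv
  obtain ⟨w, hw, hw0⟩ := Submodule.exists_mem_ne_zero_of_ne_bot hbot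
  have h3 := hg (⟨w, hw⟩, 0)
  simp only [hι, hJ, ZeroMemClass.coe_zero, map_zero, add_zero, neg_zero, zero_add] at h3
  have h4 := hPpos w hw0
  rw [← h3, h1 ⟨w, hw⟩ ⟨_, hW g w hw⟩] at h4
  exact h4.false

end

section

variable {m : ℕ}

/-- The left representation `g ↦ (v ↦ v g⁻¹)` associated with the natural right module. -/
noncomputable def rowRepresentation (G : Subgroup (GL (Fin m) ℚ)) :
    Representation ℚ G (Fin m → ℚ) where
  toFun g := Matrix.vecMulLinear 
    (((g⁻¹ : G) : GL (Fin m) ℚ) : Matrix (Fin m) (Fin m) ℚ)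
  map_one' := by ext; simp
  map_mul' g h := by
    refine LinearMap.ext fun v => ?_
    simp [Matrix.vecMul_vecMul]

theorem rowRepresentation_apply (G : Subgroup (GL (Fin m) ℚ)) (g : G) (v : Fin m → ℚ) :
    rowRepresentation G g v = v ᵥ* (((g⁻¹ : G) : GL (Fin m) ℚ) : Matrix (Fin m) (Fin m) ℚ) :=
  rfl

/-- Acting by `M` on both arguments changes the Gram matrix `A` to `M A Mᵀ`. -/
theorem toBilin'_vecMul (A M : Matrix (Fin m) (Fin m) ℚ) (x y : Fin m → ℚ) :
    A.toBilin' (x ᵥ* M) (y ᵥ* M) = (M * A * Mᵀ).toBilin' x y := by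
  simp only [Matrix.toBilin'_apply']
  rw [← Matrix.mulVec_transpose M y, ← Matrix.dotProduct_mulVec, Matrix.mulVec_mulVec,
    Matrix.mulVec_mulVec]

/-- The group of invertible matrices `g` with `g A gᵀ = A`. -/
def formStabilizer (A : Matrix (Fin m) (Fin m) ℚ) : Subgroup (GL (Fin m) ℚ) where
  carrier := {g | (g : Matrix (Fin m) (Fin m) ℚ) * A * (g : Matrix (Fin m) (Fin m) ℚ)ᵀ = A}
  one_mem' := by simp
  mul_mem' {g h} hg hh := by
    simp only [Set.mem_ofPred_eq] at hg hh ⊢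
    rw [Units.val_mul, Matrix.transpose_mul]
    conv_rhs => rw [← hg, ← hh]
    simp only [Matrix.mul_assoc]
  inv_mem' {g} hg := by
    simp only [Set.mem_ofPred_eq] at hg ⊢
    have h1 : ((g⁻¹ : GL (Fin m) ℚ) : Matrix (Fin m) (Fin m) ℚ) * (g : Matrix _ _ ℚ) = 1 := by
      rw [← Units.val_mul, inv_mul_cancel, Units.val_one]
    have h2 : (g : Matrix (Fin m) (Fin m) ℚ)ᵀ *
        ((g⁻¹ : GL (Fin m) ℚ) : Matrix (Fin m) (Fin m) ℚ)ᵀ = 1 := by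
      rw [← Matrix.transpose_mul, h1, Matrix.transpose_one]
    conv_lhs => rw [← hg]
    simp only [Matrix.mul_assoc, h2, Matrix.mul_one]
    rw [← Matrix.mul_assoc, h1, Matrix.one_mul]

/-- A maximal finite symplectic group contains every equivariant isometry of order dividing `4` of
its form. -/
theorem isSaturated_rowRepresentation {G : Subgroup (GL (Fin m) ℚ)}
    (hfin : (G : Set (GL (Fin m) ℚ)).Finite)
    (hmax : ∀ H : Subgroup (GL (Fin m) ℚ), (H : Set (GL (Fin m) ℚ)).Finite →
      IsSymplecticGroup H → G ≤ H → H = G)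
    {A : Matrix (Fin m) (Fin m) ℚ} (hskew : Aᵀ = -A) (hunit : IsUnit A)
    (hG : G ≤ formStabilizer A) : (rowRepresentation G).IsSaturated A.toBilin' := by
  intro h hpow hcomm hiso
  set M := LinearMap.toMatrixRight' h
  have hM : ∀ v, v ᵥ* M = h v := fun v => by
    rw [← Matrix.toLinearMapRight'_apply]
    exact LinearMap.congr_fun (LinearMap.toMatrixRight'.symm_apply_apply h) v
  have hM4 : M ^ 4 = 1 := by
    refine Matrix.toLinearMapRight'.injective (LinearMap.ext fun v => ?_)
    have := LinearMap.congr_fun hpow v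
    simp only [pow_succ, pow_zero, one_mul, Module.End.mul_apply, Module.End.one_apply] at this
    simp only [Matrix.toLinearMapRight'_apply, pow_succ, pow_zero, one_mul,
      ← Matrix.vecMul_vecMul, hM, this, Matrix.vecMul_one]
  let u : GL (Fin m) ℚ := Units.ofPowEqOne M 4 hM4 (by decide)
  have hu4 : u ^ 4 = 1 := Units.pow_ofPowEqOne _ _
  have huA : u ∈ formStabilizer A := by
    refine Matrix.toBilin'.injective (LinearMap.ext₂ fun x y => ?_)
    change (M * A * Mᵀ).toBilin' x y = _
    rw [← toBilin'_vecMul, hM, hM, hiso]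
  have huG : ∀ g ∈ G, Commute g u := by
    intro g hg
    refine Units.ext (Matrix.toLinearMapRight'.injective (LinearMap.ext fun v => ?_))
    have := hcomm ⟨g⁻¹, inv_mem hg⟩ v
    simp only [rowRepresentation_apply, ← hM, InvMemClass.coe_inv, inv_inv,
      Matrix.vecMul_vecMul] at this
    exact this
  have hfinu : Finite (Subgroup.zpowers u) :=
    (isOfFinOrder_iff_pow_eq_one.2 ⟨4, by decide, hu4⟩).finite_zpowers
  have hfinG : Finite G := hfin
  let F := MonoidHom.noncommCoprod G.subtype (Subgroup.zpowers u).subtype (by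
    rintro ⟨g, hg⟩ ⟨_, k, rfl⟩
    exact (huG g hg).zpow_right k)
  have hF : F.range = G ⊔ Subgroup.zpowers u := by
    simp [F, MonoidHom.noncommCoprod_range]
  have huH : u ∈ F.range := hF ▸ (le_sup_right : _ ≤ G ⊔ _) (Subgroup.mem_zpowers u)
  have hle : F.range ≤ formStabilizer A := by
    rw [hF]
    exact sup_le hG (by simpa using huA)
  rw [hmax F.range (Set.finite_range F) ⟨A, hskew, hunit, hle⟩ (hF ▸ le_sup_left)] at huH
  refine ⟨⟨u⁻¹, inv_mem huH⟩, LinearMap.ext fun v => ?_⟩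
  rw [rowRepresentation_apply, ← hM]
  simp [u]

end

/-- If `G ≤ GL_{2n}(ℚ)` is maximal finite symplectic, then the natural `ℚ[G]`-module
`ℚ^{1×2n}` is multiplicity-free: any two isomorphic simple `ℚ[G]`-submodules are equal. -/
theorem maximalFiniteSymplectic_multiplicity_free {n : ℕ}
    (G : Subgroup (GL (Fin (2 * n)) ℚ))
    (hfin : (G : Set (GL (Fin (2 * n)) ℚ)).Finite)
    (hsymp : IsSymplecticGroup G)
    (hmax : ∀ H : Subgroup (GL (Fin (2 * n)) ℚ), (H : Set (GL (Fin (2 * n)) ℚ)).Finite →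
      IsSymplecticGroup H → G ≤ H → H = G) :
    ∀ W W' : Submodule ℚ (Fin (2 * n) → ℚ), IsSimpleSubmoduleFor G W →
      IsSimpleSubmoduleFor G W' → IsModuleIsoFor G W W' → W = W' := by
  rintro W W' ⟨hbot, hW, hsimple⟩ - ⟨e, he⟩
  obtain ⟨A, hskew, hunit, hGA⟩ := hsymp
  have hsat := isSaturated_rowRepresentation hfin hmax hskew hunit hGA
  have hinv : ∀ (g : G) x y, A.toBilin' (rowRepresentation G g x) (rowRepresentation G g y) =
      A.toBilin' x y := fun g x y => by
    simp only [rowRepresentation_apply]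
    rw [toBilin'_vecMul, hGA _ (g⁻¹).2]
  have hAneg : ∀ x y, A.toBilin' x y = -A.toBilin' y x := fun x y => by
    rw [Matrix.toBilin'_apply', Matrix.toBilin'_apply', dotProduct_comm, ← Matrix.vecMul_transpose,
      ← Matrix.dotProduct_mulVec, hskew, Matrix.neg_mulVec, dotProduct_neg]
  have hAlt : A.toBilin'.IsAlt := fun x => self_eq_neg.1 (hAneg x x)
  have hAsep : ∀ x, (∀ y, A.toBilin' x y = 0) → x = 0 := by
    have hdet : A.det ≠ 0 := ((Matrix.isUnit_iff_isUnit_det A).1 hunit).ne_zero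
    exact (Matrix.nondegenerate_toBilin'_iff.2 (Matrix.nondegenerate_of_det_ne_zero hdet)).1
  have : Finite G := hfin
  have := Fintype.ofFinite G
  let s : LinearMap.BilinForm ℚ (Fin (2 * n) → ℚ) := ∑ g : G,
    (1 : Matrix (Fin (2 * n)) (Fin (2 * n)) ℚ).toBilin'.comp
      (rowRepresentation G g) (rowRepresentation G g)
  have hs : ∀ x y, s x y = ∑ g : G, rowRepresentation G g x ⬝ᵥ rowRepresentation G g y :=
    fun x y => by simp [s, Matrix.toBilin'_apply']
  obtain ⟨P, hPρ, hPsymm, hPpos⟩ := Representation.exists_adjoint_of_posDef (s := s) hAsep hinv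
    (fun x hx => by
      rw [hs]
      refine Finset.sum_pos' (fun g _ => Finset.sum_nonneg fun i _ => mul_self_nonneg _)
        ⟨1, Finset.mem_univ _, ?_⟩
      rw [map_one, Module.End.one_apply]
      simpa using dotProduct_self_star_pos_iff.2 hx)
    (fun x y => by simp only [hs, dotProduct_comm])
    (fun g x y => by
      simp only [hs, ← Module.End.mul_apply, ← map_mul]
      exact Fintype.sum_equiv (Equiv.mulRight g) _ _ fun _ => rfl)
  exact hsat.eq_of_equiv hAlt hinv hPρ hPsymm hPpos (fun g w hw => hW _ (g⁻¹).2 w hw) hbot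
    (fun U hU hUinv => hsimple U hU fun g hg v hv => by
      simpa [rowRepresentation_apply] using hUinv ⟨g⁻¹, inv_mem hg⟩ v hv)
    e (fun g w => he _ (g⁻¹).2 _ _ rfl)
end

section
/- Let G ≤ GL_{2n}(ℚ) be a finite subgroup that is rationally irreducible, symplectic, and symplectic primitive, and let N be a normal subgroup of G. Then the natural ℚ[N]-module ℚ^{1×2n} is isotypic: its natural character is a multiple of a single rationally irreducible character; equivalently, any two simple ℚ[N]-submodules of ℚ^{1×2n} are isomorphic as ℚ[N]-modules. -/
open Matrix
open scoped MatrixGroups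

/-- `G ≤ GL_m(ℚ)` is rationally irreducible. -/
def IsRatIrreducible {m : ℕ} (G : Subgroup (GL (Fin m) ℚ)) : Prop :=
  ∀ W : Submodule ℚ (Fin m → ℚ), IsInvariantSubspace G W → W = ⊥ ∨ W = ⊤

/-- `G ≤ GL_{2n}(ℚ)` is symplectic imprimitive: `G` is conjugate in `GL_{2n}(ℚ)` to a
subgroup of a wreath product `H ≀ S_k` (`k ≥ 2`, `n = d·k`) where
`H ≤ GL_{2d}(ℚ)` is the (symplectic) stabilizer of an invertible skew-symmetric form `A`,
the base group acting blockwise on `(ℚ^{1×2d})^k` and `S_k` permuting the blocks. -/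
def IsSympImprimitive {n : ℕ} (G : Subgroup (GL (Fin (2 * n)) ℚ)) : Prop :=
  ∃ (d k : ℕ), n = d * k ∧ 2 ≤ k ∧
    ∃ (e : Fin k × Fin (2 * d) ≃ Fin (2 * n))
      (A : Matrix (Fin (2 * d)) (Fin (2 * d)) ℚ) (T : GL (Fin (2 * n)) ℚ),
      Aᵀ = -A ∧ IsUnit A ∧
      ∀ g ∈ G, ∃ (σ : Equiv.Perm (Fin k)) (h : Fin k → Matrix (Fin (2 * d)) (Fin (2 * d)) ℚ),
        (∀ i, h i * A * (h i)ᵀ = A) ∧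
        ((T * g * T⁻¹ : GL (Fin (2 * n)) ℚ) : Matrix (Fin (2 * n)) (Fin (2 * n)) ℚ) =
          Matrix.reindex e e
            (Matrix.of fun p q : Fin k × Fin (2 * d) =>
              if σ p.1 = q.1 then h p.1 p.2 q.2 else 0)

section Blocks

variable {m : ℕ}

theorem vecMul_vecMul_dotProduct_of_invariant {A g : Matrix (Fin m) (Fin m) ℚ}
    (h : g * A * gᵀ = A) (v w : Fin m → ℚ) :
    (v ᵥ* g) ᵥ* A ⬝ᵥ (w ᵥ* g) = v ᵥ* A ⬝ᵥ w := by
  rw [← mulVec_transpose g w, dotProduct_mulVec, vecMul_vecMul, vecMul_vecMul, ← Matrix.mul_assoc, h]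

theorem vecMul_vecMul_inv (g : GL (Fin m) ℚ) (v : Fin m → ℚ) :
    (v ᵥ* (g : Matrix (Fin m) (Fin m) ℚ)) ᵥ*
      ((g⁻¹ : GL (Fin m) ℚ) : Matrix (Fin m) (Fin m) ℚ) = v := by
  rw [vecMul_vecMul, ← Units.val_mul, mul_inv_cancel, Units.val_one, vecMul_one]

/-- The bilinear form of a skew-symmetric matrix is antisymmetric. -/
theorem vecMul_dotProduct_skew {A : Matrix (Fin m) (Fin m) ℚ} (h : Aᵀ = -A)
    (v w : Fin m → ℚ) : v ᵥ* A ⬝ᵥ w = -(w ᵥ* A ⬝ᵥ v) := by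
  rw [← dotProduct_mulVec, ← vecMul_transpose, h, vecMul_neg, dotProduct_neg, dotProduct_comm]

/-- Averaging the standard form gives a positive definite form invariant under a finite group. -/
theorem exists_invariant_posDef (G : Subgroup (GL (Fin m) ℚ))
    (hfin : (G : Set (GL (Fin m) ℚ)).Finite) :
    ∃ S : Matrix (Fin m) (Fin m) ℚ, Sᵀ = S ∧ (∀ v, v ≠ 0 → 0 < v ᵥ* S ⬝ᵥ v) ∧
      ∀ g ∈ G, (g : Matrix (Fin m) (Fin m) ℚ) * S * (g : Matrix (Fin m) (Fin m) ℚ)ᵀ = S := by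
  classical
  refine ⟨∑ x ∈ hfin.toFinset, (x : Matrix (Fin m) (Fin m) ℚ) * (x : Matrix (Fin m) (Fin m) ℚ)ᵀ,
    ?_, ?_, ?_⟩
  · simp [transpose_sum]
  · intro v hv
    have key (x : GL (Fin m) ℚ) :
        v ᵥ* ((x : Matrix (Fin m) (Fin m) ℚ) * (x : Matrix (Fin m) (Fin m) ℚ)ᵀ) ⬝ᵥ v =
        (v ᵥ* (x : Matrix (Fin m) (Fin m) ℚ)) ⬝ᵥ (v ᵥ* (x : Matrix (Fin m) (Fin m) ℚ)) := by
      rw [← vecMul_vecMul, ← dotProduct_mulVec, mulVec_transpose]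
    simp only [vecMul_sum, sum_dotProduct, key]
    refine Finset.sum_pos (fun x _ => ?_) ⟨1, by simp [G.one_mem]⟩
    have hx : v ᵥ* (x : Matrix (Fin m) (Fin m) ℚ) ≠ 0 := by
      intro h
      apply hv
      rw [← vecMul_vecMul_inv x v, h, zero_vecMul]
    exact lt_of_le_of_ne (Finset.sum_nonneg fun i _ => mul_self_nonneg _)
      fun h => hx (dotProduct_self_eq_zero.1 h.symm)
  · intro g hg
    rw [Finset.mul_sum, Finset.sum_mul]
    refine Finset.sum_bij (fun x _ => g * x) ?_ ?_ ?_ ?_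
    · intro x hx
      simpa using G.mul_mem hg (by simpa using hx)
    · intro x _ y _ h
      simpa using h
    · intro x hx
      exact ⟨g⁻¹ * x, by simpa using G.mul_mem (G.inv_mem hg) (by simpa using hx), by simp⟩
    · intro x _
      simp [Matrix.mul_assoc]

/-- Endomorphisms of the natural module commuting with the action of `N`. -/
def IsEquivariant (N : Subgroup (GL (Fin m) ℚ)) (T : (Fin m → ℚ) →ₗ[ℚ] (Fin m → ℚ)) : Prop :=
  ∀ g ∈ N, ∀ v, T (v ᵥ* (g : Matrix (Fin m) (Fin m) ℚ)) = T v ᵥ* (g : Matrix (Fin m) (Fin m) ℚ)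

/-- Invariant subspaces that are also stable under all equivariant endomorphisms. -/
def IsFullyInvariantSubspace (N : Subgroup (GL (Fin m) ℚ)) (W : Submodule ℚ (Fin m → ℚ)) : Prop :=
  IsInvariantSubspace N W ∧ ∀ T, IsEquivariant N T → ∀ v ∈ W, T v ∈ W

/-- Equivariance of the orthogonal projection onto an invariant subspace. -/
theorem exists_equivariant_projection {N : Subgroup (GL (Fin m) ℚ)}
    {S : Matrix (Fin m) (Fin m) ℚ} (hsymm : Sᵀ = S) (hpos : ∀ v, v ≠ 0 → 0 < v ᵥ* S ⬝ᵥ v)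
    (hinv : ∀ g ∈ N, (g : Matrix (Fin m) (Fin m) ℚ) * S * (g : Matrix (Fin m) (Fin m) ℚ)ᵀ = S)
    {U : Submodule ℚ (Fin m → ℚ)} (hU : IsInvariantSubspace N U) :
    ∃ T, IsEquivariant N T ∧ (∀ v, T v ∈ U) ∧ (∀ u ∈ U, T u = u) ∧
      ∀ v, T v = 0 → ∀ u ∈ U, u ᵥ* S ⬝ᵥ v = 0 := by
  let B : LinearMap.BilinForm ℚ (Fin m → ℚ) := Matrix.toBilin' S
  have hB (v w) : B v w = v ᵥ* S ⬝ᵥ w := by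
    simp only [B, Matrix.toBilin'_apply', dotProduct_mulVec]
  have hrefl : B.IsRefl := by
    intro v w h
    rw [hB] at h ⊢
    rw [← h, ← dotProduct_mulVec, ← vecMul_transpose, hsymm, dotProduct_comm]
  have hdisj : Disjoint U (B.orthogonal U) := by
    rw [Submodule.disjoint_def]
    intro v hv hv'
    by_contra h
    have := hv' v hv
    have h2 := hpos v h
    rw [← hB] at h2
    exact h2.ne' this
  have hc : IsCompl U (B.orthogonal U) :=
    LinearMap.BilinForm.isCompl_orthogonal_of_restrict_nondegenerate hrefl
      (B.nondegenerate_restrict_of_disjoint_orthogonal hrefl hdisj)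
  refine ⟨U.projection _ hc, ?_, fun v => Submodule.projection_apply_mem hc v,
    fun u hu => Submodule.projection_apply_of_mem_left hc hu, ?_⟩
  · intro g hg v
    obtain ⟨u, hu, w, hw, rfl⟩ : ∃ u ∈ U, ∃ w ∈ B.orthogonal U, u + w = v :=
      Submodule.mem_sup.1 (hc.sup_eq_top ▸ Submodule.mem_top)
    have hwg : w ᵥ* (g : Matrix (Fin m) (Fin m) ℚ) ∈ B.orthogonal U := by
      intro x hx
      have h := hw _ (hU g⁻¹ (N.inv_mem hg) x hx)
      have hx' := vecMul_vecMul_inv g⁻¹ x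
      rw [inv_inv] at hx'
      change B _ _ = 0
      rw [← hx', hB, vecMul_vecMul_dotProduct_of_invariant (hinv g hg), ← hB]
      exact h
    rw [add_vecMul, map_add, map_add, Submodule.projection_apply_of_mem_left hc hu,
      Submodule.projection_apply_of_mem_left hc (hU g hg u hu),
      Submodule.projection_apply_of_mem_right hc hw,
      Submodule.projection_apply_of_mem_right hc hwg, add_zero, add_zero]
  · intro v hv u hu
    rw [← hB]
    exact (Submodule.projection_apply_eq_zero_iff hc).1 hv u hu

/-- If there is no proper nonzero fully invariant subspace, the module is isotypic. -/
theorem isModuleIsoFor_of_fullyInvariant_trivial {N : Subgroup (GL (Fin m) ℚ)}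
    {S : Matrix (Fin m) (Fin m) ℚ} (hsymm : Sᵀ = S) (hpos : ∀ v, v ≠ 0 → 0 < v ᵥ* S ⬝ᵥ v)
    (hinv : ∀ g ∈ N, (g : Matrix (Fin m) (Fin m) ℚ) * S * (g : Matrix (Fin m) (Fin m) ℚ)ᵀ = S)
    (htriv : ∀ U, IsFullyInvariantSubspace N U → U = ⊥ ∨ U = ⊤)
    {W W' : Submodule ℚ (Fin m → ℚ)} (hW : IsSimpleSubmoduleFor N W)
    (hW' : IsSimpleSubmoduleFor N W') : IsModuleIsoFor N W W' := by
  obtain ⟨P, hPN, hPmem, hPid, -⟩ := exists_equivariant_projection hsymm hpos hinv hW'.2.1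
  obtain ⟨T, hT, hne⟩ : ∃ T, IsEquivariant N T ∧ ∃ w ∈ W, P (T w) ≠ 0 := by
    by_contra! hcon
    let K : Submodule ℚ (Fin m → ℚ) := ⨆ T : {T // IsEquivariant N T}, W.map T.1
    have hK : IsFullyInvariantSubspace N K := by
      refine ⟨fun g hg v hv => ?_, fun T hT v hv => ?_⟩
      · have : K ≤ K.comap (vecMulLinear (g : Matrix (Fin m) (Fin m) ℚ)) := by
          refine iSup_le fun T => ?_
          rintro _ ⟨w, hw, rfl⟩
          change T.1 w ᵥ* _ ∈ K
          rw [← T.2 g hg]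
          exact (le_iSup (fun T : {T // IsEquivariant N T} => W.map T.1) T)
            (Submodule.mem_map_of_mem (hW.2.1 g hg w hw))
        exact this hv
      · have : K ≤ K.comap T := by
          refine iSup_le fun T₁ => ?_
          rintro _ ⟨w, hw, rfl⟩
          exact (le_iSup (fun T : {T // IsEquivariant N T} => W.map T.1)
            ⟨T ∘ₗ T₁.1, fun g hg v => by simp [T₁.2 g hg, hT g hg]⟩) ⟨w, hw, rfl⟩
        exact this hv
    have hWK : W ≤ K := fun w hw =>
      (le_iSup (fun T : {T // IsEquivariant N T} => W.map T.1)
        ⟨LinearMap.id, fun _ _ _ => rfl⟩) ⟨w, hw, rfl⟩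
    have hKtop : K = ⊤ := (htriv K hK).resolve_left fun h => hW.1 (le_bot_iff.1 (h ▸ hWK))
    have hKP : K ≤ LinearMap.ker P := by
      refine iSup_le fun T => ?_
      rintro _ ⟨w, hw, rfl⟩
      exact hcon T.1 T.2 w hw
    refine hW'.1 ((Submodule.eq_bot_iff _).2 fun w hw => ?_)
    rw [← hPid w hw]
    exact hKP (hKtop ▸ Submodule.mem_top)
  have hF : IsEquivariant N (P ∘ₗ T) := fun g hg v => by simp [hT g hg, hPN g hg]
  generalize hFdef : P ∘ₗ T = F at hF
  have hFmem (v) : F v ∈ W' := hFdef ▸ hPmem _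
  obtain ⟨w₀, hw₀, hFw₀⟩ : ∃ w ∈ W, F w ≠ 0 := hFdef ▸ hne
  have hker : W ⊓ LinearMap.ker F = ⊥ := by
    refine (hW.2.2 _ inf_le_left fun g hg v hv => ⟨hW.2.1 g hg v hv.1, ?_⟩).resolve_right fun h => ?_
    · have : F v = 0 := hv.2
      change F _ = 0
      rw [hF g hg, this, zero_vecMul]
    · rw [← h] at hw₀
      exact hFw₀ hw₀.2
  have himg : W.map F = W' := by
    refine (hW'.2.2 _ ?_ ?_).resolve_left fun h => ?_
    · rintro _ ⟨w, -, rfl⟩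
      exact hFmem w
    · rintro g hg _ ⟨w, hw, rfl⟩
      exact ⟨_, hW.2.1 g hg w hw, hF g hg w⟩
    · have : F w₀ ∈ W.map F := ⟨w₀, hw₀, rfl⟩
      rw [h] at this
      exact hFw₀ this
  refine ⟨LinearEquiv.ofBijective (F.restrict fun w _ => hFmem w) ⟨?_, ?_⟩, ?_⟩
  · rw [← LinearMap.ker_eq_bot, LinearMap.ker_eq_bot']
    intro w hw
    have : (w : Fin m → ℚ) ∈ W ⊓ LinearMap.ker F := ⟨w.2, congrArg Subtype.val hw⟩
    rw [hker] at this
    exact Subtype.ext this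
  · rintro ⟨w, hw⟩
    rw [← himg] at hw
    obtain ⟨v, hv, rfl⟩ := hw
    exact ⟨⟨v, hv⟩, rfl⟩
  · intro g hg w w' h
    change F w' = F w ᵥ* _
    rw [h, hF g hg]

/-- Distinct minimal fully invariant subspaces are orthogonal for every invariant form. -/
theorem vecMul_dotProduct_eq_zero_of_fullyInvariant {N : Subgroup (GL (Fin m) ℚ)}
    {S A : Matrix (Fin m) (Fin m) ℚ} (hsymm : Sᵀ = S) (hpos : ∀ v, v ≠ 0 → 0 < v ᵥ* S ⬝ᵥ v)
    (hS : ∀ g ∈ N, (g : Matrix (Fin m) (Fin m) ℚ) * S * (g : Matrix (Fin m) (Fin m) ℚ)ᵀ = S)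
    (hA : ∀ g ∈ N, (g : Matrix (Fin m) (Fin m) ℚ) * A * (g : Matrix (Fin m) (Fin m) ℚ)ᵀ = A)
    {U W : Submodule ℚ (Fin m → ℚ)} (hU : IsFullyInvariantSubspace N U)
    (hW : IsFullyInvariantSubspace N W) (hUW : U ⊓ W = ⊥) :
    ∀ u ∈ U, ∀ w ∈ W, u ᵥ* A ⬝ᵥ w = 0 := by
  have hSu : IsUnit S.det := by
    rw [isUnit_iff_ne_zero]
    intro h
    obtain ⟨v, hv, hv0⟩ := exists_vecMul_eq_zero_iff.2 h
    have := hpos v hv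
    rw [hv0, zero_dotProduct] at this
    exact this.false
  obtain ⟨P, hPN, hPmem, -, hPker⟩ := exists_equivariant_projection hsymm hpos hS hU.1
  have horth : ∀ u ∈ U, ∀ w ∈ W, u ᵥ* S ⬝ᵥ w = 0 := by
    intro u hu w hw
    refine hPker w ?_ u hu
    have : P w ∈ U ⊓ W := ⟨hPmem w, hW.2 P hPN w hw⟩
    rwa [hUW] at this
  have hφ : IsEquivariant N (vecMulLinear (A * S⁻¹)) := by
    intro g hg v
    have hcomm : (g : Matrix (Fin m) (Fin m) ℚ) * (A * S⁻¹) = A * S⁻¹ * g := by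
      have h1 := hS g hg
      have h2 := hA g hg
      set M : Matrix (Fin m) (Fin m) ℚ := (g : Matrix (Fin m) (Fin m) ℚ)
      have hMt : IsUnit Mᵀ.det := by
        rw [det_transpose]
        exact (isUnit_iff_isUnit_det _).1 g.isUnit
      have h3 : S⁻¹ * M = Mᵀ⁻¹ * S⁻¹ := by
        have : M * S = S * Mᵀ⁻¹ := by
          rw [← mul_nonsing_inv_cancel_right (A := Mᵀ) (M * S) hMt, h1]
        calc S⁻¹ * M = S⁻¹ * (M * S) * S⁻¹ := by
              rw [← Matrix.mul_assoc, mul_nonsing_inv_cancel_right _ _ hSu]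
          _ = Mᵀ⁻¹ * S⁻¹ := by rw [this, nonsing_inv_mul_cancel_left _ _ hSu]
      have h4 : M * A = A * Mᵀ⁻¹ := by
        rw [← mul_nonsing_inv_cancel_right (A := Mᵀ) (M * A) hMt, h2]
      rw [← Matrix.mul_assoc, h4, Matrix.mul_assoc, Matrix.mul_assoc, h3]
    simp only [vecMulLinear_apply, vecMul_vecMul, hcomm]
  intro u hu w hw
  have h := horth _ (hU.2 _ hφ u hu) w hw
  rwa [vecMulLinear_apply, vecMul_vecMul, nonsing_inv_mul_cancel_right _ _ hSu] at h

/-- The image `W g` of a subspace of row vectors. -/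
def rowTranslate (W : Submodule ℚ (Fin m → ℚ)) (g : GL (Fin m) ℚ) : Submodule ℚ (Fin m → ℚ) :=
  W.map (vecMulLinear (g : Matrix (Fin m) (Fin m) ℚ))

theorem vecMul_mem_rowTranslate {W : Submodule ℚ (Fin m → ℚ)} (g : GL (Fin m) ℚ) {v : Fin m → ℚ}
    (hv : v ∈ W) : v ᵥ* (g : Matrix (Fin m) (Fin m) ℚ) ∈ rowTranslate W g :=
  ⟨v, hv, rfl⟩

theorem rowTranslate_mul (W : Submodule ℚ (Fin m → ℚ)) (g h : GL (Fin m) ℚ) :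
    rowTranslate W (g * h) = rowTranslate (rowTranslate W g) h := by
  simp only [rowTranslate, ← Submodule.map_comp]
  congr 1
  refine LinearMap.ext fun v => ?_
  simp [← vecMul_vecMul]

theorem rowTranslate_one (W : Submodule ℚ (Fin m → ℚ)) : rowTranslate W 1 = W := by
  ext v
  simp [rowTranslate]

theorem rowTranslate_inf (U W : Submodule ℚ (Fin m → ℚ)) (g : GL (Fin m) ℚ) :
    rowTranslate (U ⊓ W) g = rowTranslate U g ⊓ rowTranslate W g := by
  refine Submodule.map_inf _ fun v w h => ?_
  rw [← vecMul_vecMul_inv g v, ← vecMul_vecMul_inv g w]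
  exact congrArg (· ᵥ* _) h

theorem IsFullyInvariantSubspace.rowTranslate {N : Subgroup (GL (Fin m) ℚ)} {g : GL (Fin m) ℚ}
    (hg : ∀ x ∈ N, g * x * g⁻¹ ∈ N) (hg' : ∀ x ∈ N, g⁻¹ * x * g ∈ N)
    {W : Submodule ℚ (Fin m → ℚ)} (hW : IsFullyInvariantSubspace N W) :
    IsFullyInvariantSubspace N (rowTranslate W g) := by
  constructor
  · rintro x hx _ ⟨v, hv, rfl⟩
    refine ⟨_, hW.1 _ (hg x hx) v hv, ?_⟩
    simp only [vecMulLinear_apply, vecMul_vecMul, ← Units.val_mul]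
    simp [mul_assoc]
  · rintro T hT _ ⟨v, hv, rfl⟩
    have hT' : IsEquivariant N (vecMulLinear ((g⁻¹ : GL (Fin m) ℚ) : Matrix (Fin m) (Fin m) ℚ) ∘ₗ
        T ∘ₗ vecMulLinear (g : Matrix (Fin m) (Fin m) ℚ)) := by
      intro x hx v
      have h := hT _ (hg' x hx) (v ᵥ* (g : Matrix (Fin m) (Fin m) ℚ))
      have e1 : g * (g⁻¹ * x * g) = x * g := by group
      have e2 : g⁻¹ * x * g * g⁻¹ = g⁻¹ * x := by group
      simp only [LinearMap.comp_apply, vecMulLinear_apply]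
      rw [vecMul_vecMul, ← Units.val_mul, e1] at h
      rw [vecMul_vecMul v, ← Units.val_mul, h, vecMul_vecMul, ← Units.val_mul, e2, Units.val_mul,
        ← vecMul_vecMul]
    refine ⟨_, hW.2 _ hT' v hv, ?_⟩
    have h := vecMul_vecMul_inv g⁻¹ (T (v ᵥ* (g : Matrix (Fin m) (Fin m) ℚ)))
    rw [inv_inv] at h
    exact h

theorem IsFullyInvariantSubspace.inf {N : Subgroup (GL (Fin m) ℚ)}
    {U W : Submodule ℚ (Fin m → ℚ)} (hU : IsFullyInvariantSubspace N U)
    (hW : IsFullyInvariantSubspace N W) : IsFullyInvariantSubspace N (U ⊓ W) :=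
  ⟨fun g hg v hv => ⟨hU.1 g hg v hv.1, hW.1 g hg v hv.2⟩,
    fun T hT v hv => ⟨hU.2 T hT v hv.1, hW.2 T hT v hv.2⟩⟩

/-- The Gram matrix of a finite family of vectors for the form `A`. -/
def gramOf {ι : Type*} (A : Matrix (Fin m) (Fin m) ℚ) (b : ι → Fin m → ℚ) : Matrix ι ι ℚ :=
  Matrix.of fun i j => b i ᵥ* A ⬝ᵥ b j

theorem gramOf_transpose {ι : Type*} {A : Matrix (Fin m) (Fin m) ℚ} (hA : Aᵀ = -A)
    (b : ι → Fin m → ℚ) : (gramOf A b)ᵀ = -gramOf A b := by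
  ext i j
  exact vecMul_dotProduct_skew hA _ _

theorem isUnit_gramOf {ι : Type*} [Fintype ι] [DecidableEq ι] {A : Matrix (Fin m) (Fin m) ℚ}
    {U : Submodule ℚ (Fin m → ℚ)}
    (hU : ∀ v ∈ U, (∀ w ∈ U, v ᵥ* A ⬝ᵥ w = 0) → v = 0) (b : Module.Basis ι ℚ U) :
    IsUnit (gramOf A fun i => (b i : Fin m → ℚ)) := by
  rw [isUnit_iff_isUnit_det, isUnit_iff_ne_zero]
  intro h
  obtain ⟨x, hx, hx0⟩ := exists_vecMul_eq_zero_iff.2 h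
  have hv : ((∑ i, x i • b i : U) : Fin m → ℚ) = 0 := by
    refine hU _ (Subtype.property _) fun w hw => ?_
    have hb (j : ι) : ((∑ i, x i • b i : U) : Fin m → ℚ) ᵥ* A ⬝ᵥ (b j : Fin m → ℚ) = 0 := by
      refine Eq.trans ?_ (congrFun hx0 j)
      simp only [Submodule.coe_sum, Submodule.coe_smul, sum_vecMul, smul_vecMul, sum_dotProduct,
        smul_dotProduct]
      simp [vecMul, dotProduct, gramOf]
    have hw' := congrArg Subtype.val (b.sum_repr ⟨w, hw⟩)
    simp only [Submodule.coe_sum, Submodule.coe_smul] at hw'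
    rw [← hw', dotProduct_sum]
    exact Finset.sum_eq_zero fun j _ => by rw [dotProduct_smul, hb, smul_zero]
  have hz := Fintype.linearIndependent_iff.1 b.linearIndependent x (Subtype.ext hv)
  exact hx (funext hz)

theorem even_card_of_isUnit_skew {ι : Type*} [Fintype ι] [DecidableEq ι] {A : Matrix ι ι ℚ}
    (hA : Aᵀ = -A) (hu : IsUnit A) : Even (Fintype.card ι) := by
  by_contra hodd
  rw [Nat.not_even_iff_odd] at hodd
  have h := congrArg det hA
  rw [det_transpose, det_neg, hodd.neg_one_pow] at h
  exact ((isUnit_iff_isUnit_det _).1 hu).ne_zero (by linarith)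

/-- A transitive system of at least two pairwise orthogonal blocks makes a symplectic group
imprimitive. -/
theorem isSympImprimitive_of_orthogonal_blocks {n k : ℕ} {G : Subgroup (GL (Fin (2 * n)) ℚ)}
    {A : Matrix (Fin (2 * n)) (Fin (2 * n)) ℚ} (hA : Aᵀ = -A) (hu : IsUnit A)
    (hinv : ∀ g ∈ G, (g : Matrix (Fin (2 * n)) (Fin (2 * n)) ℚ) * A *
      (g : Matrix (Fin (2 * n)) (Fin (2 * n)) ℚ)ᵀ = A)
    (hk : 2 ≤ k) (U : Fin k → Submodule ℚ (Fin (2 * n) → ℚ))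
    (hperm : ∀ g ∈ G, ∃ σ : Equiv.Perm (Fin k), ∀ i, rowTranslate (U i) g = U (σ i))
    {U₀ : Submodule ℚ (Fin (2 * n) → ℚ)} (htrans : ∀ i, ∃ g ∈ G, rowTranslate U₀ g = U i)
    (horth : ∀ i j, i ≠ j → ∀ v ∈ U i, ∀ w ∈ U j, v ᵥ* A ⬝ᵥ w = 0)
    (hsup : ⨆ i, U i = ⊤) : IsSympImprimitive G := by
  choose t htG ht using htrans
  have hnondeg : ∀ v ∈ U₀, (∀ w ∈ U₀, v ᵥ* A ⬝ᵥ w = 0) → v = 0 := by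
    intro v hv h
    let i₀ : Fin k := ⟨0, by omega⟩
    set v' := v ᵥ* (t i₀ : Matrix (Fin (2 * n)) (Fin (2 * n)) ℚ) with hv'
    have hv'mem : v' ∈ U i₀ := ht i₀ ▸ vecMul_mem_rowTranslate _ hv
    have hle : ⨆ i, U i ≤ LinearMap.ker (dotProductBilin ℚ ℚ (v' ᵥ* A)) := by
      refine iSup_le fun i w hw => ?_
      change v' ᵥ* A ⬝ᵥ w = 0
      by_cases hi : i₀ = i
      · subst hi
        rw [← ht i₀] at hw
        obtain ⟨w, hw, rfl⟩ := hw
        rw [vecMulLinear_apply, hv',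
          vecMul_vecMul_dotProduct_of_invariant (hinv _ (htG _)), h w hw]
      · exact horth _ _ hi _ hv'mem _ hw
    rw [hsup] at hle
    have h0 : v' ᵥ* A = 0 :=
      dotProduct_eq_zero _ fun w => hle (Submodule.mem_top (x := w))
    have h1 : v' = 0 := by
      have := congrArg (· ᵥ* A⁻¹) h0
      simpa [vecMul_vecMul, mul_nonsing_inv _ ((isUnit_iff_isUnit_det _).1 hu)] using this
    rw [← vecMul_vecMul_inv (t i₀) v, ← hv', h1, zero_vecMul]
  obtain ⟨d, hd⟩ : ∃ d, Module.finrank ℚ U₀ = 2 * d := by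
    have := even_card_of_isUnit_skew (gramOf_transpose hA _)
      (isUnit_gramOf hnondeg (Module.finBasis ℚ U₀))
    rw [Fintype.card_fin] at this
    obtain ⟨d, hd⟩ := this
    exact ⟨d, by omega⟩
  let b : Module.Basis (Fin (2 * d)) ℚ U₀ := Module.finBasisOfFinrankEq ℚ U₀ hd
  let A₀ := gramOf A fun a => (b a : Fin (2 * n) → ℚ)
  have hA₀ : IsUnit A₀ := isUnit_gramOf hnondeg b
  let f : Fin k × Fin (2 * d) → Fin (2 * n) → ℚ := fun p =>
    (b p.2 : Fin (2 * n) → ℚ) ᵥ* (t p.1 : Matrix (Fin (2 * n)) (Fin (2 * n)) ℚ)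
  have hfmem (p) : f p ∈ U p.1 := ht p.1 ▸ vecMul_mem_rowTranslate _ (b p.2).2
  have hgram (i a c) : f (i, a) ᵥ* A ⬝ᵥ f (i, c) = A₀ a c :=
    vecMul_vecMul_dotProduct_of_invariant (hinv _ (htG i)) _ _
  have hf : LinearIndependent ℚ f := by
    rw [Fintype.linearIndependent_iff]
    rintro x hx ⟨i, a⟩
    have hz : (fun a => x (i, a)) ᵥ* A₀ = 0 := by
      ext c
      have h : (∑ p, x p • f p) ᵥ* A ⬝ᵥ f (i, c) = 0 := by rw [hx, zero_vecMul, zero_dotProduct]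
      simp only [sum_vecMul, smul_vecMul, sum_dotProduct, smul_dotProduct,
        Fintype.sum_prod_type] at h
      rw [Finset.sum_eq_single i] at h
      · simpa only [hgram] using! h
      · intro j _ hj
        exact Finset.sum_eq_zero fun a _ => by
          rw [horth _ _ hj _ (hfmem (j, a)) _ (hfmem (i, c)), smul_zero]
      · simp
    have hz' : (fun a => x (i, a)) = 0 := by
      have := congrArg (· ᵥ* A₀⁻¹) hz
      simpa [vecMul_vecMul, mul_nonsing_inv _ ((isUnit_iff_isUnit_det _).1 hA₀)] using this
    exact congrFun hz' a
  have hexpand (i) (v) (hv : v ∈ U₀) :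
      v ᵥ* (t i : Matrix (Fin (2 * n)) (Fin (2 * n)) ℚ) = ∑ c, b.repr ⟨v, hv⟩ c • f (i, c) := by
    have h := congrArg Subtype.val (b.sum_repr ⟨v, hv⟩)
    simp only [Submodule.coe_sum, Submodule.coe_smul] at h
    conv_lhs => rw [← h]
    simp only [sum_vecMul, smul_vecMul, f]
  have hspan : ⊤ ≤ Submodule.span ℚ (Set.range f) := by
    rw [← hsup]
    refine iSup_le fun i => ?_
    rw [← ht i]
    rintro _ ⟨v, hv, rfl⟩
    rw [vecMulLinear_apply, hexpand i v hv]
    exact Submodule.sum_mem _ fun c _ =>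
      Submodule.smul_mem _ _ (Submodule.subset_span ⟨_, rfl⟩)
  let fb := Module.Basis.mk hf hspan
  have hcard : Fintype.card (Fin k × Fin (2 * d)) = Fintype.card (Fin (2 * n)) := by
    rw [← Module.finrank_eq_card_basis fb, Module.finrank_fintype_fun_eq_card]
  let e := Fintype.equivOfCardEq hcard
  have hTunit : IsUnit (Matrix.of fun p => f (e.symm p)) :=
    linearIndependent_rows_iff_isUnit.1 (hf.comp e.symm e.symm.injective)
  refine ⟨d, k, ?_, hk, e, A₀, hTunit.unit, gramOf_transpose hA _, hA₀, fun g hg => ?_⟩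
  · simp only [Fintype.card_prod, Fintype.card_fin] at hcard
    linarith
  obtain ⟨σ, hσ⟩ := hperm g hg
  have hmem (i) (a) : (b a : Fin (2 * n) → ℚ) ᵥ*
      ((t i * g * (t (σ i))⁻¹ : GL (Fin (2 * n)) ℚ) : Matrix (Fin (2 * n)) (Fin (2 * n)) ℚ)
        ∈ U₀ := by
    have h : rowTranslate U₀ (t i * g * (t (σ i))⁻¹) = U₀ := by
      rw [rowTranslate_mul, rowTranslate_mul, ht, hσ, ← ht (σ i), ← rowTranslate_mul, mul_inv_cancel,
        rowTranslate_one]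
    exact h.le (vecMul_mem_rowTranslate _ (b a).2)
  let h : Fin k → Matrix (Fin (2 * d)) (Fin (2 * d)) ℚ := fun i =>
    Matrix.of fun a c => b.repr ⟨_, hmem i a⟩ c
  have hrow (i a) : f (i, a) ᵥ* (g : Matrix (Fin (2 * n)) (Fin (2 * n)) ℚ) =
      ∑ c, h i a c • f (σ i, c) := by
    refine Eq.trans ?_ (hexpand (σ i) _ (hmem i a))
    simp only [f, vecMul_vecMul, ← Units.val_mul, inv_mul_cancel_right]
  refine ⟨σ, h, fun i => ?_, ?_⟩
  · ext a c
    rw [← hgram i a c, ← vecMul_vecMul_dotProduct_of_invariant (hinv g hg), hrow, hrow]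
    simp only [sum_vecMul, smul_vecMul, sum_dotProduct, smul_dotProduct, dotProduct_sum,
      dotProduct_smul, hgram, Matrix.mul_apply, transpose_apply, smul_eq_mul, Finset.sum_mul,
      Finset.mul_sum]
    exact Finset.sum_congr rfl fun _ _ => Finset.sum_congr rfl fun _ _ => by ring
  · rw [Units.val_mul, Units.val_mul, coe_units_inv]
    have hdet : IsUnit (hTunit.unit : Matrix (Fin (2 * n)) (Fin (2 * n)) ℚ).det :=
      (isUnit_iff_isUnit_det _).1 hTunit.unit.isUnit
    suffices hM : (hTunit.unit : Matrix (Fin (2 * n)) (Fin (2 * n)) ℚ) * g =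
        Matrix.reindex e e (Matrix.of fun p q : Fin k × Fin (2 * d) =>
          if σ p.1 = q.1 then h p.1 p.2 q.2 else 0) * hTunit.unit by
      rw [hM, mul_nonsing_inv_cancel_right _ _ hdet]
    ext p j
    obtain ⟨⟨i, a⟩, rfl⟩ := e.surjective p
    have hl : ((hTunit.unit : Matrix (Fin (2 * n)) (Fin (2 * n)) ℚ) * g) (e (i, a)) j =
        (f (i, a) ᵥ* (g : Matrix (Fin (2 * n)) (Fin (2 * n)) ℚ)) j := by
      simp [Matrix.mul_apply, vecMul, dotProduct]
    rw [hl, hrow, Matrix.mul_apply, ← e.sum_comp]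
    simp [Fintype.sum_prod_type, ite_mul, Finset.sum_ite_irrel]

end Blocks

/-- If `G ≤ GL_{2n}(ℚ)` is finite, rationally irreducible, symplectic and symplectic
primitive, and `N ⊴ G`, then the natural `ℚ[N]`-module `ℚ^{1×2n}` is isotypic: any two
simple `ℚ[N]`-submodules of `ℚ^{1×2n}` are isomorphic. -/
theorem sympPrimitive_normal_subgroup_isotypic {n : ℕ}
    (G N : Subgroup (GL (Fin (2 * n)) ℚ))
    (hfin : (G : Set (GL (Fin (2 * n)) ℚ)).Finite)
    (hirr : IsRatIrreducible G)
    (hsymp : IsSymplecticGroup G)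
    (hprim : ¬ IsSympImprimitive G)
    (hNG : N ≤ G)
    (hnormal : ∀ g ∈ G, ∀ x ∈ N, g * x * g⁻¹ ∈ N) :
    ∀ W W' : Submodule ℚ (Fin (2 * n) → ℚ), IsSimpleSubmoduleFor N W →
      IsSimpleSubmoduleFor N W' → IsModuleIsoFor N W W' := by
  intro W W' hW hW'
  obtain ⟨S, hsymm, hpos, hS⟩ := exists_invariant_posDef G hfin
  have hSN := fun g hg => hS g (hNG hg)
  refine isModuleIsoFor_of_fullyInvariant_trivial hsymm hpos hSN (fun X hX => ?_) hW hW'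
  by_contra! hX'
  obtain ⟨A, hA, hu, hAG⟩ := hsymp
  obtain ⟨U, ⟨hU, hU0⟩, hmin⟩ := WellFounded.has_min
    (wellFounded_lt (α := Submodule ℚ (Fin (2 * n) → ℚ)))
    {U | IsFullyInvariantSubspace N U ∧ U ≠ ⊥} ⟨X, hX, hX'.1⟩
  have htr {g} (hg : g ∈ G) {V} (hV : IsFullyInvariantSubspace N V) :
      IsFullyInvariantSubspace N (rowTranslate V g) :=
    hV.rowTranslate (hnormal g hg) fun x hx => by
      simpa using hnormal g⁻¹ (G.inv_mem hg) x hx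
  have hinv (V : Submodule ℚ (Fin (2 * n) → ℚ)) (g : GL (Fin (2 * n)) ℚ) :
      rowTranslate (rowTranslate V g) g⁻¹ = V := by
    rw [← rowTranslate_mul, mul_inv_cancel, rowTranslate_one]
  have hinj {V V' : Submodule ℚ (Fin (2 * n) → ℚ)} {g : GL (Fin (2 * n)) ℚ}
      (h : rowTranslate V g = rowTranslate V' g) : V = V' := by
    rw [← hinv V g, h, hinv]
  have hmin' (V) (hV : IsFullyInvariantSubspace N V) (h : ¬ U ≤ V) : U ⊓ V = ⊥ := by
    by_contra h0
    exact hmin _ ⟨hU.inf hV, h0⟩ (inf_le_left.lt_of_ne fun h' => h (h' ▸ inf_le_right))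
  have hmeet {g g'} (hg : g ∈ G) (hg' : g' ∈ G) (hne : rowTranslate U g ≠ rowTranslate U g') :
      rowTranslate U g ⊓ rowTranslate U g' = ⊥ := by
    have e : rowTranslate U g' = rowTranslate (rowTranslate U (g' * g⁻¹)) g := by
      rw [← rowTranslate_mul, inv_mul_cancel_right]
    rw [e] at hne ⊢
    rw [← rowTranslate_inf, hmin' _ (htr (G.mul_mem hg' (G.inv_mem hg)) hU) fun hle => ?_]
    · exact Submodule.map_bot _
    · have := Submodule.eq_of_le_of_finrank_le hle (Submodule.finrank_map_le _ _)
      exact hne (congrArg (rowTranslate · g) this)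
  let I := {V : Submodule ℚ (Fin (2 * n) → ℚ) // ∃ g ∈ G, rowTranslate U g = V}
  have : Finite I := (hfin.image (rowTranslate U)).to_subtype
  have : Fintype I := Fintype.ofFinite I
  let ε := Fintype.equivFin I
  let shift (g) (hg : g ∈ G) (V : I) : I :=
    ⟨rowTranslate V.1 g, by
      obtain ⟨x, hx, hV⟩ := V.2
      exact ⟨x * g, G.mul_mem hx hg, by rw [rowTranslate_mul, hV]⟩⟩
  have hshift (g) (hg : g ∈ G) : Function.Bijective (shift g hg) :=
    Finite.injective_iff_bijective.1 fun V V' h => Subtype.ext (hinj (congrArg Subtype.val h))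
  have hUI : ∃ g ∈ G, rowTranslate U g = U := ⟨1, G.one_mem, rowTranslate_one U⟩
  have hsup : ⨆ V : I, V.1 = ⊤ := by
    refine (hirr _ fun g hg v hv => ?_).resolve_left fun h => hU0 ?_
    · have hle : ⨆ V : I, V.1 ≤
          (⨆ V : I, V.1).comap (vecMulLinear (g : Matrix (Fin (2 * n)) (Fin (2 * n)) ℚ)) :=
        iSup_le fun V w hw =>
          le_iSup (fun V : I => V.1) (shift g hg V) (vecMul_mem_rowTranslate g hw)
      exact hle hv
    · exact le_bot_iff.1 (h ▸ le_iSup (fun V : I => V.1) ⟨U, hUI⟩)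
  have hnt : Nontrivial I := by
    by_contra hs
    rw [not_nontrivial_iff_subsingleton] at hs
    refine (hirr U fun g hg v hv => ?_).elim hU0 fun h =>
      hmin X ⟨hX, hX'.1⟩ (h ▸ lt_top_iff_ne_top.2 hX'.2)
    have : (⟨rowTranslate U g, g, hg, rfl⟩ : I) = ⟨U, hUI⟩ := Subsingleton.elim _ _
    exact (congrArg Subtype.val this).le (vecMul_mem_rowTranslate g hv)
  refine hprim (isSympImprimitive_of_orthogonal_blocks hA hu hAG
    (Fintype.one_lt_card_iff_nontrivial.2 hnt) (fun i => (ε.symm i).1) (fun g hg =>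
      ⟨ε.permCongr (Equiv.ofBijective _ (hshift g hg)), fun i => by simp [shift]⟩)
    (fun i => (ε.symm i).2) (fun i j hij => ?_) ?_)
  · obtain ⟨g, hg, hgi⟩ := (ε.symm i).2
    obtain ⟨g', hg', hgj⟩ := (ε.symm j).2
    have hne : (ε.symm i).1 ≠ (ε.symm j).1 := fun h => hij (ε.symm.injective (Subtype.ext h))
    rw [← hgi, ← hgj] at hne ⊢
    exact vecMul_dotProduct_eq_zero_of_fullyInvariant hsymm hpos hSN
      (fun g hg => hAG g (hNG hg)) (htr hg hU) (htr hg' hU) (hmeet hg hg' hne)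
  · rw [← hsup]
    exact ε.symm.iSup_comp (g := fun V : I => V.1)
end

section
/- Let G ≤ GL_{2n}(ℚ) be a finite subgroup that is rationally irreducible, symplectic, and symplectic primitive, and let p be a prime. If G contains a nontrivial normal p-subgroup (i.e., O_p(G) ≠ 1), then p − 1 divides 2n. -/
open Matrix
open scoped MatrixGroups

namespace SympPrimitive

variable {m : ℕ}

/-- The stabilizer in `GL_m(ℚ)` of a row vector. -/
def vecStabilizer (v : Fin m → ℚ) : Subgroup (GL (Fin m) ℚ) where
  carrier := {g | v ᵥ* (g : Matrix (Fin m) (Fin m) ℚ) = v}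
  one_mem' := by simp
  mul_mem' := by
    intro a b ha hb
    simp only [Set.mem_ofPred_eq] at ha hb ⊢
    rw [Units.val_mul, ← Matrix.vecMul_vecMul, ha, hb]
  inv_mem' := by
    intro a ha
    simp only [Set.mem_ofPred_eq] at ha ⊢
    conv_lhs => rw [← ha]
    rw [Matrix.vecMul_vecMul, ← Units.val_mul, mul_inv_cancel, Units.val_one, Matrix.vecMul_one]

theorem mem_vecStabilizer {v : Fin m → ℚ} {g : GL (Fin m) ℚ} :
    g ∈ vecStabilizer v ↔ v ᵥ* (g : Matrix (Fin m) (Fin m) ℚ) = v := Iff.rfl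

/-- The space of row vectors fixed by a subgroup of `GL_m(ℚ)`. -/
def fixedSpace (K : Subgroup (GL (Fin m) ℚ)) : Submodule ℚ (Fin m → ℚ) where
  carrier := {v | K ≤ vecStabilizer v}
  zero_mem' := fun g _ => by simp [mem_vecStabilizer]
  add_mem' := by
    intro a b ha hb g hg
    have h1 := ha hg
    have h2 := hb hg
    rw [mem_vecStabilizer] at *
    rw [Matrix.add_vecMul, h1, h2]
  smul_mem' := by
    intro c a ha g hg
    have h1 := ha hg
    rw [mem_vecStabilizer] at *
    rw [Matrix.smul_vecMul, h1]

theorem mem_fixedSpace {K : Subgroup (GL (Fin m) ℚ)} {v : Fin m → ℚ} :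
    v ∈ fixedSpace K ↔ K ≤ vecStabilizer v := Iff.rfl

theorem vecMul_mul_coe (v : Fin m → ℚ) (g h : GL (Fin m) ℚ) :
    v ᵥ* (g : Matrix (Fin m) (Fin m) ℚ) ᵥ* (h : Matrix (Fin m) (Fin m) ℚ) =
      v ᵥ* ((g * h : GL (Fin m) ℚ) : Matrix (Fin m) (Fin m) ℚ) := by
  rw [Matrix.vecMul_vecMul, Units.val_mul]

/-- The image of a subspace under the right action of a matrix. -/
def translate (W : Submodule ℚ (Fin m → ℚ)) (g : GL (Fin m) ℚ) : Submodule ℚ (Fin m → ℚ) :=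
  W.map (Matrix.vecMulLinear (g : Matrix (Fin m) (Fin m) ℚ))

theorem mem_translate {W : Submodule ℚ (Fin m → ℚ)} {g : GL (Fin m) ℚ} {v : Fin m → ℚ} :
    v ∈ translate W g ↔ v ᵥ* ((g⁻¹ : GL (Fin m) ℚ) : Matrix (Fin m) (Fin m) ℚ) ∈ W := by
  constructor
  · rintro ⟨w, hw, rfl⟩
    rw [Matrix.vecMulLinear_apply, vecMul_mul_coe, mul_inv_cancel, Units.val_one,
      Matrix.vecMul_one]
    exact hw
  · intro h
    refine ⟨_, h, ?_⟩
    rw [Matrix.vecMulLinear_apply, vecMul_mul_coe, inv_mul_cancel, Units.val_one,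
      Matrix.vecMul_one]

theorem vecMul_mem_translate {W : Submodule ℚ (Fin m → ℚ)} (g : GL (Fin m) ℚ) {v : Fin m → ℚ}
    (hv : v ∈ W) : v ᵥ* (g : Matrix (Fin m) (Fin m) ℚ) ∈ translate W g :=
  ⟨v, hv, rfl⟩

theorem translate_one (W : Submodule ℚ (Fin m → ℚ)) : translate W 1 = W := by
  ext v
  simp [mem_translate]

theorem translate_mul (W : Submodule ℚ (Fin m → ℚ)) (g h : GL (Fin m) ℚ) :
    translate W (g * h) = translate (translate W g) h := by
  ext v
  simp only [mem_translate, vecMul_mul_coe, _root_.mul_inv_rev]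

theorem translate_injective (g : GL (Fin m) ℚ) :
    Function.Injective fun W : Submodule ℚ (Fin m → ℚ) => translate W g := by
  intro W W' h
  have h' := congrArg (fun U => translate U g⁻¹) h
  simpa only [← translate_mul, mul_inv_cancel, translate_one] using h'

theorem mem_fixedSpace_map_conj {K : Subgroup (GL (Fin m) ℚ)} {g : GL (Fin m) ℚ}
    {v : Fin m → ℚ} :
    v ∈ fixedSpace (K.map (MulAut.conj g⁻¹).toMonoidHom) ↔ v ∈ translate (fixedSpace K) g := by
  rw [mem_translate, mem_fixedSpace, mem_fixedSpace, Subgroup.map_le_iff_le_comap]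
  refine forall₂_congr fun x _ => ?_
  rw [Subgroup.mem_comap, mem_vecStabilizer, mem_vecStabilizer, vecMul_mul_coe]
  simp only [MulEquiv.toMonoidHom_eq_coe, MonoidHom.coe_coe, MulAut.conj_apply, inv_inv]
  constructor
  · intro h
    conv_rhs => rw [← h]
    rw [vecMul_mul_coe, mul_inv_cancel_right]
  · intro h
    have h' := congrArg (fun w => w ᵥ* (g : Matrix (Fin m) (Fin m) ℚ)) h
    simpa only [vecMul_mul_coe, inv_mul_cancel, Units.val_one, Matrix.vecMul_one] using h'

theorem fixedSpace_map_conj (K : Subgroup (GL (Fin m) ℚ)) (g : GL (Fin m) ℚ) :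
    fixedSpace (K.map (MulAut.conj g⁻¹).toMonoidHom) = translate (fixedSpace K) g :=
  Submodule.ext fun _ => mem_fixedSpace_map_conj

theorem form_vecMul_vecMul {A M : Matrix (Fin m) (Fin m) ℚ} (h : M * A * Mᵀ = A)
    (u v : Fin m → ℚ) : (u ᵥ* M) ⬝ᵥ (A *ᵥ (v ᵥ* M)) = u ⬝ᵥ (A *ᵥ v) := by
  rw [← Matrix.mulVec_transpose M v, ← Matrix.dotProduct_mulVec, Matrix.mulVec_mulVec,
    Matrix.mulVec_mulVec, h]

theorem eq_zero_of_form_eq_zero {A : Matrix (Fin m) (Fin m) ℚ} (hA : IsUnit A) {u : Fin m → ℚ}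
    (h : ∀ v, u ⬝ᵥ (A *ᵥ v) = 0) : u = 0 := by
  apply Matrix.vecMul_injective_of_isUnit hA
  simp only [Matrix.zero_vecMul]
  refine dotProduct_eq_zero _ fun w => ?_
  rw [← Matrix.dotProduct_mulVec, h]

/-- An endomorphism of prime order `p` without nonzero fixed vectors turns a rational vector
space into a vector space over the `p`-th cyclotomic field. -/
theorem sub_one_dvd_finrank {V : Type*} [AddCommGroup V] [Module ℚ V] [FiniteDimensional ℚ V]
    {p : ℕ} (hp : p.Prime) (f : Module.End ℚ V) (hf : f ^ p = 1)
    (hfix : ∀ v, f v = v → v = 0) : p - 1 ∣ Module.finrank ℚ V := by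
  have : Fact p.Prime := ⟨hp⟩
  have hinj : ∀ g : Module.End ℚ V, (f - 1) * g = 0 → g = 0 := by
    intro g hg
    ext v
    apply hfix
    have := LinearMap.congr_fun hg v
    simpa [sub_eq_zero] using this
  have hcyc : Polynomial.aeval f (Polynomial.cyclotomic p ℚ) = 0 := by
    apply hinj
    have h := congrArg (Polynomial.aeval f) (Polynomial.cyclotomic_prime_mul_X_sub_one ℚ p)
    rw [mul_comm] at h
    simpa [hf] using h
  have hirr : Irreducible (Polynomial.cyclotomic p ℚ) :=
    Polynomial.cyclotomic.irreducible_rat hp.pos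
  have : Fact (Irreducible (Polynomial.cyclotomic p ℚ)) := ⟨hirr⟩
  let K := AdjoinRoot (Polynomial.cyclotomic p ℚ)
  let φ : K →ₐ[ℚ] Module.End ℚ V :=
    Ideal.Quotient.liftₐ (Ideal.span {Polynomial.cyclotomic p ℚ}) (Polynomial.aeval f)
      fun a ha => by
        obtain ⟨q, rfl⟩ := Ideal.mem_span_singleton.1 ha
        rw [map_mul, hcyc, zero_mul]
  let _ : Module K V := Module.compHom V φ.toRingHom
  have : IsScalarTower ℚ K V := ⟨fun a b v => by
    change φ (a • b) v = a • φ b v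
    simp⟩
  have hK : Module.finrank ℚ K = p - 1 := by
    rw [(AdjoinRoot.powerBasis hirr.ne_zero).finrank, AdjoinRoot.powerBasis_dim,
      Polynomial.natDegree_cyclotomic, Nat.totient_prime hp]
  exact ⟨_, by rw [← hK, Module.finrank_mul_finrank ℚ K V]⟩

/-- A proper nonzero subspace whose translates either coincide with it or are orthogonal to it
gives a system of symplectic imprimitivity. -/
theorem isSympImprimitive_of_block {n : ℕ} {G : Subgroup (GL (Fin (2 * n)) ℚ)}
    (hfin : (G : Set (GL (Fin (2 * n)) ℚ)).Finite) (hirr : IsRatIrreducible G)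
    {A : Matrix (Fin (2 * n)) (Fin (2 * n)) ℚ} (hAt : Aᵀ = -A) (hA : IsUnit A)
    (hG : ∀ g ∈ G, (g : Matrix (Fin (2 * n)) (Fin (2 * n)) ℚ) * A *
      (g : Matrix (Fin (2 * n)) (Fin (2 * n)) ℚ)ᵀ = A)
    {W : Submodule ℚ (Fin (2 * n) → ℚ)} (hbot : W ≠ ⊥) (htop : W ≠ ⊤)
    (hW : ∀ g ∈ G, translate W g = W ∨
      ∀ u ∈ translate W g, ∀ w ∈ W, u ⬝ᵥ (A *ᵥ w) = 0) :
    IsSympImprimitive G := by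
  classical
  let O : Set (Submodule ℚ (Fin (2 * n) → ℚ)) := translate W '' (G : Set _)
  have hWO : W ∈ O := ⟨1, G.one_mem, translate_one W⟩
  have : Finite O := (hfin.image _).to_subtype
  have : Fintype O := Fintype.ofFinite O
  have hOmem : ∀ i : O, ∀ g ∈ G, translate i.1 g ∈ O := by
    rintro ⟨_, x, hx, rfl⟩ g hg
    exact ⟨x * g, G.mul_mem hx hg, translate_mul W x g⟩
  have horth : ∀ i j : O, i ≠ j → ∀ u ∈ i.1, ∀ v ∈ j.1, u ⬝ᵥ (A *ᵥ v) = 0 := by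
    rintro ⟨_, x, hx, rfl⟩ ⟨_, y, hy, rfl⟩ hij u hu v hv
    have hyi := G.inv_mem hy
    rcases hW (x * y⁻¹) (G.mul_mem hx hyi) with h | h
    · refine absurd (Subtype.ext ?_) hij
      have h' := congrArg (fun U => translate U y) h
      simpa only [← translate_mul, inv_mul_cancel_right] using h'
    · rw [← form_vecMul_vecMul (hG _ hyi)]
      apply h
      · rw [translate_mul]
        exact vecMul_mem_translate _ hu
      · exact mem_translate.1 hv
  have hspan : (⨆ i : O, i.1) = ⊤ := by
    refine (hirr _ ?_).resolve_left ?_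
    · intro g hg v hv
      refine Submodule.iSup_induction (fun i : O => i.1)
        (motive := fun v => v ᵥ* (g : Matrix (Fin (2 * n)) (Fin (2 * n)) ℚ) ∈ ⨆ i : O, i.1) hv ?_ ?_ ?_
      · intro i x hx
        exact Submodule.mem_iSup_of_mem (⟨_, hOmem i g hg⟩ : O) (vecMul_mem_translate g hx)
      · simp
      · intro x y hx hy
        rw [Matrix.add_vecMul]
        exact Submodule.add_mem _ hx hy
    · intro h
      exact hbot (eq_bot_iff.2 (h ▸ le_iSup (fun i : O => i.1) ⟨W, hWO⟩))
  have hnd : ∀ i : O, ∀ u ∈ i.1, (∀ v ∈ i.1, u ⬝ᵥ (A *ᵥ v) = 0) → u = 0 := by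
    intro i u hu h
    refine eq_zero_of_form_eq_zero hA fun v => ?_
    have hv : v ∈ ⨆ i : O, i.1 := hspan ▸ Submodule.mem_top
    refine Submodule.iSup_induction (fun i : O => i.1)
      (motive := fun v => u ⬝ᵥ (A *ᵥ v) = 0) hv ?_ ?_ ?_
    · intro j x hx
      by_cases hij : i = j
      · subst hij
        exact h x hx
      · exact horth i j hij u hu x hx
    · simp
    · intro x y hx hy
      rw [Matrix.mulVec_add, dotProduct_add, hx, hy, add_zero]
  choose rep hrepG hrep using fun i : O => i.2
  obtain ⟨r, ⟨b⟩⟩ : ∃ r, Nonempty (Module.Basis (Fin r) ℚ W) := ⟨_, ⟨Module.finBasis ℚ W⟩⟩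
  let c : O × Fin r → (Fin (2 * n) → ℚ) := fun q =>
    (b q.2 : Fin (2 * n) → ℚ) ᵥ* (rep q.1 : Matrix (Fin (2 * n)) (Fin (2 * n)) ℚ)
  have hcmem : ∀ q, c q ∈ q.1.1 := fun q => by
    have h := vecMul_mem_translate (rep q.1) (b q.2).2
    rwa [hrep] at h
  have hbspan : ∀ i : O, ∀ v ∈ i.1, ∃ t : Fin r → ℚ, v = ∑ a, t a • c (i, a) := by
    intro i v hv
    rw [← hrep i] at hv
    obtain ⟨w, hw, rfl⟩ := hv
    refine ⟨fun a => b.repr ⟨w, hw⟩ a, ?_⟩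
    have h := congrArg (Matrix.vecMulLinear (rep i : Matrix (Fin (2 * n)) (Fin (2 * n)) ℚ) ∘ₗ W.subtype)
      (b.sum_repr ⟨w, hw⟩)
    rw [map_sum] at h
    simp only [map_smul] at h
    exact h.symm
  have hblock : ∀ i : O, ∀ t : Fin r → ℚ, ∑ a, t a • c (i, a) = 0 → t = 0 := by
    intro i t ht
    have hz : W.subtype (∑ a, t a • b a) = 0 := by
      apply Matrix.vecMul_injective_of_isUnit (rep i).isUnit
      have h : Matrix.vecMulLinear (rep i : Matrix (Fin (2 * n)) (Fin (2 * n)) ℚ) (W.subtype (∑ a, t a • b a)) = 0 := by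
        rw [map_sum, map_sum, ← ht]
        simp only [map_smul]
        rfl
      exact h.trans (Matrix.zero_vecMul _).symm
    rw [Submodule.subtype_apply, Submodule.coe_eq_zero] at hz
    exact funext fun a => Fintype.linearIndependent_iff.1 b.linearIndependent t hz a
  have hli : LinearIndependent ℚ c := by
    rw [Fintype.linearIndependent_iff]
    intro t ht
    rintro ⟨i, a⟩
    refine congrFun (hblock i (fun a => t (i, a)) (hnd i _ ?_ ?_)) a
    · exact Submodule.sum_mem _ fun a _ => Submodule.smul_mem _ _ (hcmem (i, a))
    · intro v hv
      have h : (∑ q, t q • c q) ⬝ᵥ (A *ᵥ v) = 0 := by rw [ht, zero_dotProduct]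
      rw [Fintype.sum_prod_type, sum_dotProduct,
        Finset.sum_eq_single i (fun j _ hj => ?_) (by simp)] at h
      · exact h
      · exact horth j i hj _
          (Submodule.sum_mem _ fun a _ => Submodule.smul_mem _ _ (hcmem (j, a))) v hv
  have hcspan : ⊤ ≤ Submodule.span ℚ (Set.range c) := by
    rw [← hspan]
    refine iSup_le fun i v hv => ?_
    obtain ⟨t, rfl⟩ := hbspan i v hv
    exact Submodule.sum_mem _ fun a _ => Submodule.smul_mem _ _ (Submodule.subset_span ⟨_, rfl⟩)
  have hcard : Fintype.card O * r = 2 * n := by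
    have h := Module.finrank_eq_card_basis (Module.Basis.mk hli hcspan)
    simpa using h.symm
  have hk : 2 ≤ Fintype.card O := by
    rw [Nat.succ_le_iff, Fintype.one_lt_card_iff_nontrivial]
    by_contra hcon
    rw [not_nontrivial_iff_subsingleton] at hcon
    refine htop (eq_top_iff.2 (hspan ▸ iSup_le fun i => ?_))
    rw [Subsingleton.elim i ⟨W, hWO⟩]
  let A' : Matrix (Fin r) (Fin r) ℚ := Matrix.of fun a a' =>
    (b a : Fin (2 * n) → ℚ) ⬝ᵥ (A *ᵥ (b a' : Fin (2 * n) → ℚ))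
  have hA't : A'ᵀ = -A' := by
    ext a a'
    simp only [A', Matrix.transpose_apply, Matrix.of_apply, Matrix.neg_apply]
    rw [Matrix.dotProduct_mulVec, ← Matrix.mulVec_transpose, hAt, Matrix.neg_mulVec,
      neg_dotProduct, dotProduct_comm]
  have hA'c : ∀ i a a', c (i, a) ⬝ᵥ (A *ᵥ c (i, a')) = A' a a' := fun i a a' =>
    form_vecMul_vecMul (hG _ (hrepG i)) _ _
  have hA'u : IsUnit A' := by
    rw [← Matrix.vecMul_injective_iff_isUnit]
    refine (injective_iff_map_eq_zero (Matrix.vecMulLinear A')).2 fun t ht => ?_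
    refine hblock ⟨W, hWO⟩ t (hnd ⟨W, hWO⟩ _ ?_ ?_)
    · exact Submodule.sum_mem _ fun a _ => Submodule.smul_mem _ _ (hcmem (⟨W, hWO⟩, a))
    · intro v hv
      obtain ⟨s, rfl⟩ := hbspan ⟨W, hWO⟩ v hv
      rw [Matrix.mulVec_sum, dotProduct_sum]
      refine Finset.sum_eq_zero fun a' _ => ?_
      rw [Matrix.mulVec_smul, dotProduct_smul, sum_dotProduct]
      simp only [smul_dotProduct, hA'c]
      have h := congrFun ht a'
      simp only [Matrix.vecMulLinear_apply, Matrix.vecMul, dotProduct, Pi.zero_apply] at h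
      simp [h]
  have hreven : Even r := by
    by_contra hodd
    rw [Nat.not_even_iff_odd] at hodd
    have h := congrArg Matrix.det hA't
    rw [Matrix.det_transpose, Matrix.det_neg, Fintype.card_fin, hodd.neg_one_pow] at h
    have h0 : A'.det = 0 := by linarith
    exact ((Matrix.isUnit_iff_isUnit_det _).1 hA'u).ne_zero h0
  obtain ⟨d, hd⟩ := hreven
  have hr : r = 2 * d := by omega
  subst hr
  let ε : O ≃ Fin (Fintype.card O) := Fintype.equivFin O
  let e : Fin (Fintype.card O) × Fin (2 * d) ≃ Fin (2 * n) :=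
    finProdFinEquiv.trans (finCongr hcard)
  let T : Matrix (Fin (2 * n)) (Fin (2 * n)) ℚ := Matrix.of fun x =>
    c (ε.symm (e.symm x).1, (e.symm x).2)
  have hT : IsUnit T := by
    rw [← Matrix.linearIndependent_rows_iff_isUnit]
    exact hli.comp (fun x => (ε.symm (e.symm x).1, (e.symm x).2)) fun x y hxy => by
      simp only [Prod.mk.injEq, EmbeddingLike.apply_eq_iff_eq] at hxy
      exact e.symm.injective (Prod.ext hxy.1 hxy.2)
  refine ⟨d, Fintype.card O, by nlinarith [hcard], hk, e, A', hT.unit, hA't, hA'u, ?_⟩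
  intro g hg
  let τ : O → O := fun i => ⟨translate i.1 g, hOmem i g hg⟩
  have hτ : Function.Bijective τ := by
    refine Finite.injective_iff_bijective.1 fun i j hij => ?_
    exact Subtype.ext (translate_injective g (congrArg Subtype.val hij))
  have hcg : ∀ i a, ∃ t : Fin (2 * d) → ℚ,
      c (i, a) ᵥ* (g : Matrix (Fin (2 * n)) (Fin (2 * n)) ℚ) = ∑ a', t a' • c (τ i, a') := fun i a =>
    hbspan (τ i) _ (vecMul_mem_translate g (hcmem (i, a)))
  choose h hh using hcg
  refine ⟨ε.symm.trans ((Equiv.ofBijective τ hτ).trans ε),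
    fun i => Matrix.of (h (ε.symm i)), ?_, ?_⟩
  · intro i
    ext a a'
    rw [← hA'c (ε.symm i) a a', ← form_vecMul_vecMul (hG g hg), hh, hh, Matrix.mulVec_sum,
      dotProduct_sum, Matrix.mul_apply]
    refine Finset.sum_congr rfl fun x _ => ?_
    rw [Matrix.mulVec_smul, dotProduct_smul, sum_dotProduct, Matrix.mul_apply,
      Matrix.transpose_apply, smul_eq_mul, mul_comm]
    simp only [smul_dotProduct, hA'c, Matrix.of_apply, smul_eq_mul]
  · rw [Units.val_mul, Units.val_mul]
    have hmul : T * (g : Matrix (Fin (2 * n)) (Fin (2 * n)) ℚ) = Matrix.reindex e e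
        (Matrix.of fun p q : Fin (Fintype.card O) × Fin (2 * d) =>
          if (ε.symm.trans ((Equiv.ofBijective τ hτ).trans ε)) p.1 = q.1
            then Matrix.of (h (ε.symm p.1)) p.2 q.2 else 0) * T := by
      ext x y
      have hx := congrFun (hh (ε.symm (e.symm x).1) (e.symm x).2) y
      calc (T * (g : Matrix (Fin (2 * n)) (Fin (2 * n)) ℚ)) x y
          = (c (ε.symm (e.symm x).1, (e.symm x).2) ᵥ* (g : Matrix (Fin (2 * n)) (Fin (2 * n)) ℚ)) y := rfl
        _ = _ := by
          rw [hx, Matrix.mul_apply, ← e.sum_comp, Fintype.sum_prod_type, Finset.sum_apply,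
            Finset.sum_eq_single (ε (τ (ε.symm (e.symm x).1)))]
          · simp [T]
          · intro j _ hj
            refine Finset.sum_eq_zero fun a _ => ?_
            simp [Ne.symm hj]
          · simp
    change T * (g : Matrix (Fin (2 * n)) (Fin (2 * n)) ℚ) * ((hT.unit⁻¹ : GL (Fin (2 * n)) ℚ) : Matrix (Fin (2 * n)) (Fin (2 * n)) ℚ) = _
    rw [hmul, mul_assoc, IsUnit.mul_val_inv, mul_one]

/-- In a symplectic primitive group, every nontrivial subgroup of an abelian normal subgroup acts
without nonzero fixed vectors. -/
theorem fixedSpace_eq_bot_of_abelian_normal {n : ℕ}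
    {G : Subgroup (GL (Fin (2 * n)) ℚ)}
    (hfin : (G : Set (GL (Fin (2 * n)) ℚ)).Finite) (hirr : IsRatIrreducible G)
    (hsymp : IsSymplecticGroup G) (hprim : ¬ IsSympImprimitive G)
    {E : Subgroup (GL (Fin (2 * n)) ℚ)} (hEG : E ≤ G)
    (hcomm : ∀ x ∈ E, ∀ y ∈ E, x * y = y * x) (hnorm : ∀ g ∈ G, ∀ x ∈ E, g * x * g⁻¹ ∈ E)
    {K : Subgroup (GL (Fin (2 * n)) ℚ)} (hKE : K ≤ E) (hK : K ≠ ⊥) : fixedSpace K = ⊥ := by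
  classical
  obtain ⟨A, hAt, hA, hG⟩ := hsymp
  have hEfin : ∀ {H : Subgroup (GL (Fin (2 * n)) ℚ)}, H ≤ E → Finite H := fun hH =>
    (hfin.subset fun _ hx => hEG (hH hx)).to_subtype
  let S : Set ℕ := {N | ∃ H ≤ E, fixedSpace H ≠ ⊥ ∧ Nat.card H = N}
  by_contra hKfix
  have hSne : S.Nonempty := ⟨_, K, hKE, hKfix, rfl⟩
  have hSbdd : BddAbove S := by
    refine ⟨Nat.card E, ?_⟩
    rintro _ ⟨H, hHE, -, rfl⟩
    have := hEfin le_rfl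
    exact Subgroup.card_le_of_le hHE
  obtain ⟨H, hHE, hHfix, hHcard⟩ := Nat.sSup_mem hSne hSbdd
  have hmax : ∀ H' ≤ E, fixedSpace H' ≠ ⊥ → Nat.card H' ≤ Nat.card H := fun H' h1 h2 =>
    hHcard ▸ le_csSup hSbdd ⟨H', h1, h2, rfl⟩
  have := hEfin hHE
  have : Fintype H := Fintype.ofFinite H
  have hHtop : fixedSpace H ≠ ⊤ := by
    intro h
    have hH1 : H = ⊥ := by
      rw [eq_bot_iff]
      intro x hx
      rw [Subgroup.mem_bot]
      apply Units.ext
      refine Matrix.ext_of_single_vecMul fun i => ?_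
      have hi : Pi.single i 1 ∈ fixedSpace H := h ▸ Submodule.mem_top
      rw [Units.val_one, Matrix.vecMul_one]
      exact hi hx
    have hle := hmax K hKE hKfix
    rw [hH1, Subgroup.card_bot] at hle
    have := hEfin hKE
    exact hK (Subgroup.eq_bot_of_card_le K hle)
  refine hprim (isSympImprimitive_of_block hfin hirr hAt hA hG hHfix hHtop fun g hg => ?_)
  by_contra! hcon
  obtain ⟨hne, u, hu, w, hw, huw⟩ := hcon
  let H' := H.map (MulAut.conj g⁻¹).toMonoidHom
  have hH'E : H' ≤ E := by
    rintro _ ⟨x, hx, rfl⟩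
    exact hnorm g⁻¹ (G.inv_mem hg) x (hHE hx)
  have hcardH' : Nat.card H' = Nat.card H :=
    Nat.card_congr (H.equivMapOfInjective _ (MulAut.conj g⁻¹).injective).symm.toEquiv
  have hu' : u ∈ fixedSpace H' := mem_fixedSpace_map_conj.2 hu
  let y : Fin (2 * n) → ℚ := ∑ x : H, u ᵥ* ((x : GL (Fin (2 * n)) ℚ) : Matrix (Fin (2 * n)) (Fin (2 * n)) ℚ)
  have hyw : y ⬝ᵥ (A *ᵥ w) = Nat.card H * (u ⬝ᵥ (A *ᵥ w)) := by
    rw [sum_dotProduct, Finset.sum_congr rfl fun x _ => ?_, Finset.sum_const, nsmul_eq_mul,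
      Finset.card_univ, Nat.card_eq_fintype_card]
    have hwx := hw x.2
    rw [mem_vecStabilizer] at hwx
    rw [← form_vecMul_vecMul (hG _ (hEG (hHE x.2))) u w, hwx]
  have hy0 : y ≠ 0 := by
    intro h
    rw [h, zero_dotProduct] at hyw
    exact mul_ne_zero (Nat.cast_ne_zero.2 Nat.card_pos.ne') huw hyw.symm
  have hyH : H ≤ vecStabilizer y := by
    intro z hz
    rw [mem_vecStabilizer]
    simp only [y, Matrix.sum_vecMul, vecMul_mul_coe]
    exact Fintype.sum_equiv (Equiv.mulRight (⟨z, hz⟩ : H)) _ _ fun x => rfl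
  have hyH' : H' ≤ vecStabilizer y := by
    intro z hz
    rw [mem_vecStabilizer]
    simp only [y, Matrix.sum_vecMul]
    refine Finset.sum_congr rfl fun x _ => ?_
    have huz := hu' hz
    rw [mem_vecStabilizer] at huz
    rw [vecMul_mul_coe, hcomm _ (hHE x.2) _ (hH'E hz), ← vecMul_mul_coe, huz]
  have hsupE : H ⊔ H' ≤ E := sup_le hHE hH'E
  have := hEfin hsupE
  have hle : Nat.card ↥(H ⊔ H') ≤ Nat.card H := hmax _ hsupE
    ((Submodule.ne_bot_iff _).2 ⟨y, mem_fixedSpace.2 (sup_le hyH hyH'), hy0⟩)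
  have h1 : H = H ⊔ H' := Subgroup.eq_of_le_of_card_ge le_sup_left hle
  have h2 : H' = H ⊔ H' := Subgroup.eq_of_le_of_card_ge le_sup_right (hcardH' ▸ hle)
  apply hne
  rw [← fixedSpace_map_conj]
  exact congrArg fixedSpace (h2.trans h1.symm)

end SympPrimitive

open SympPrimitive

/-- If `G ≤ GL_{2n}(ℚ)` is finite, rationally irreducible, symplectic and symplectic
primitive, and `G` has a nontrivial normal `p`-subgroup (`O_p(G) ≠ 1`), then `p − 1`
divides `2n`. -/
theorem sympPrimitive_Op_ne_one {n p : ℕ} (hp : p.Prime)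
    (G : Subgroup (GL (Fin (2 * n)) ℚ))
    (hfin : (G : Set (GL (Fin (2 * n)) ℚ)).Finite)
    (hirr : IsRatIrreducible G)
    (hsymp : IsSymplecticGroup G)
    (hprim : ¬ IsSympImprimitive G)
    (hOp : ∃ P : Subgroup G, P ≠ ⊥ ∧ P.Normal ∧ IsPGroup p P) :
    p - 1 ∣ 2 * n := by
  obtain ⟨P, hP, hPn, hPp⟩ := hOp
  have : Fact p.Prime := ⟨hp⟩
  have : Finite G := hfin.to_subtype
  have : Nontrivial P := (Subgroup.nontrivial_iff_ne_bot P).2 hP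
  have := hPp.center_nontrivial
  let C : Subgroup G := (Subgroup.center P).map P.subtype
  have hC : C.Normal := ConjAct.normal_of_characteristic_of_normal
  obtain ⟨z, hz⟩ : ∃ z : Subgroup.center P, orderOf z = p := by
    apply exists_prime_orderOf_dvd_card'
    obtain ⟨k, hk0, hk⟩ := (hPp.to_subgroup _).nontrivial_iff_card.1 this
    exact hk ▸ dvd_pow_self p hk0.ne'
  let x : GL (Fin (2 * n)) ℚ := z
  have hxord : orderOf x = p := by
    simpa only [x, Subgroup.orderOf_coe] using hz
  have hxC : x ∈ C.map G.subtype := ⟨_, ⟨_, z.2, rfl⟩, rfl⟩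
  have hfix : fixedSpace (Subgroup.zpowers x) = ⊥ := by
    refine fixedSpace_eq_bot_of_abelian_normal hfin hirr hsymp hprim
      (E := C.map G.subtype) (Subgroup.map_subtype_le C) ?_ ?_ ?_ ?_
    · rintro _ ⟨_, ⟨a, ha, rfl⟩, rfl⟩ _ ⟨_, ⟨b, -, rfl⟩, rfl⟩
      simp only [← map_mul]
      rw [Subgroup.mem_center_iff.1 ha b]
    · rintro g hg _ ⟨a, ha, rfl⟩
      exact ⟨_, hC.conj_mem a ha ⟨g, hg⟩, rfl⟩
    · rwa [Subgroup.zpowers_le]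
    · rw [Subgroup.zpowers_ne_bot]
      intro h
      rw [h, orderOf_one] at hxord
      exact hp.one_lt.ne hxord
  have hpow : ∀ k : ℕ, Matrix.vecMulLinear (x : Matrix (Fin (2 * n)) (Fin (2 * n)) ℚ) ^ k =
      Matrix.vecMulLinear ((x ^ k : GL (Fin (2 * n)) ℚ) : Matrix (Fin (2 * n)) (Fin (2 * n)) ℚ) := by
    intro k
    induction k with
    | zero => ext; simp
    | succ k ih =>
      refine LinearMap.ext fun v => ?_
      rw [pow_succ', ih, Module.End.mul_apply, pow_succ]
      simp only [Matrix.vecMulLinear_apply, vecMul_mul_coe]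
  have h := sub_one_dvd_finrank hp (Matrix.vecMulLinear (x : Matrix (Fin (2 * n)) (Fin (2 * n)) ℚ)) ?_ ?_
  · simpa using h
  · rw [hpow, ← hxord, pow_orderOf_eq_one]
    ext
    simp
  · intro v hv
    rw [← Submodule.mem_bot ℚ, ← hfix, mem_fixedSpace, Subgroup.zpowers_le]
    exact hv
end

section
/- Let G ≤ GL_{2n}(ℚ) be a finite subgroup that is rationally irreducible, symplectic, and symplectic primitive, let p be a prime, let P be a normal subgroup of G that is a p-group, and let A be a characteristic subgroup of P that is abelian. Then A is cyclic. -/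
open Matrix
open scoped MatrixGroups

section Average

variable {R : Type*} [Ring R] [Algebra ℚ R]

/-- The average of the elements of a finite group `K` of units of a `ℚ`-algebra. -/
noncomputable def Subgroup.average (K : Subgroup Rˣ) : R :=
  (Nat.card K : ℚ)⁻¹ • ∑ᶠ k : K, ((k : Rˣ) : R)

namespace Subgroup

theorem average_mul_of_mem (K : Subgroup Rˣ) [Finite K] {g : Rˣ} (hg : g ∈ K) :
    K.average * g = K.average := by
  have := Fintype.ofFinite K
  simp only [average, finsum_eq_sum_of_fintype, smul_mul_assoc, Finset.sum_mul]
  congr 1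
  exact Fintype.sum_equiv (Equiv.mulRight (⟨g, hg⟩ : K)) _ _ fun x => by simp

theorem mul_average_of_forall_mul_eq (K : Subgroup Rˣ) [Finite K] {x : R}
    (hx : ∀ k ∈ K, x * (k : Rˣ) = x) : x * K.average = x := by
  have := Fintype.ofFinite K
  have h : (Fintype.card K : ℚ) ≠ 0 := by exact_mod_cast Fintype.card_ne_zero
  simp only [average, finsum_eq_sum_of_fintype, mul_smul_comm, Finset.mul_sum]
  rw [Finset.sum_congr rfl fun k _ => hx k.1 k.2]
  rw [Finset.sum_const, Finset.card_univ, Nat.card_eq_fintype_card, ← Nat.cast_smul_eq_nsmul ℚ,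
    smul_smul, inv_mul_cancel₀ h, one_smul]

theorem average_mul_self (K : Subgroup Rˣ) [Finite K] : K.average * K.average = K.average :=
  K.mul_average_of_forall_mul_eq fun _ hk => K.average_mul_of_mem hk

theorem average_bot : (⊥ : Subgroup Rˣ).average = (1 : R) := by
  simpa using (⊥ : Subgroup Rˣ).mul_average_of_forall_mul_eq (x := 1) (by simp)

theorem commute_average (K : Subgroup Rˣ) [Finite K] {x : R}
    (hx : ∀ k ∈ K, Commute x (k : Rˣ)) : Commute x K.average := by
  have := Fintype.ofFinite K
  simp only [average, finsum_eq_sum_of_fintype]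
  exact (Commute.sum_right _ _ _ fun k _ => hx k.1 k.2).smul_right _

theorem conj_average (K : Subgroup Rˣ) [Finite K] (g : Rˣ) :
    (g : R) * K.average * (g⁻¹ : Rˣ) = (K.map (MulAut.conj g).toMonoidHom).average := by
  have := Fintype.ofFinite K
  let φ := K.equivMapOfInjective (MulAut.conj g).toMonoidHom (MulAut.conj g).injective
  have := Fintype.ofEquiv _ φ.toEquiv
  simp only [average, finsum_eq_sum_of_fintype, smul_mul_assoc, Finset.sum_mul, mul_smul_comm,
    Finset.mul_sum, Nat.card_congr φ.toEquiv]
  congr 1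
  exact Fintype.sum_equiv φ.toEquiv _ _ fun x => by simp [φ]; rfl

end Subgroup

end Average

theorem Subgroup.average_mul_form {m : ℕ} (K : Subgroup (GL (Fin m) ℚ)) [Finite K]
    {B : Matrix (Fin m) (Fin m) ℚ}
    (hB : ∀ g ∈ K, (g : Matrix (Fin m) (Fin m) ℚ) * B * (g : Matrix (Fin m) (Fin m) ℚ)ᵀ = B) :
    K.average * B = B * K.averageᵀ := by
  have := Fintype.ofFinite K
  simp only [average, finsum_eq_sum_of_fintype, smul_mul_assoc, Finset.sum_mul, mul_smul_comm,
    Finset.mul_sum, Matrix.transpose_smul, Matrix.transpose_sum]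
  congr 1
  refine Fintype.sum_equiv (Equiv.inv K) _ _ fun x => ?_
  have h : ((x : GL (Fin m) ℚ) : Matrix (Fin m) (Fin m) ℚ)ᵀ *
      (((x : GL (Fin m) ℚ)⁻¹ : GL (Fin m) ℚ) : Matrix (Fin m) (Fin m) ℚ)ᵀ = 1 := by
    rw [← Matrix.transpose_mul, ← Units.val_mul, inv_mul_cancel, Units.val_one,
      Matrix.transpose_one]
  calc _ = (x : GL (Fin m) ℚ) * B * (((x : GL (Fin m) ℚ) : Matrix (Fin m) (Fin m) ℚ)ᵀ *
      (((x : GL (Fin m) ℚ)⁻¹ : GL (Fin m) ℚ) : Matrix (Fin m) (Fin m) ℚ)ᵀ) := by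
        rw [h, mul_one]
    _ = _ := by rw [← mul_assoc, hB _ x.2]; rfl

/-- A finite abelian group of units of a nontrivial `ℚ`-algebra is cyclic as soon as the
elements of each of its nontrivial subgroups sum to zero. -/
theorem isCyclic_of_sum_subgroup_eq_zero {R N : Type*} [Ring R] [Nontrivial R] [Algebra ℚ R]
    [CommGroup N] [Finite N] (ψ : N →* R)
    (h : ∀ L : Subgroup N, L ≠ ⊥ → ∑ᶠ l : L, ψ l = 0) : IsCyclic N := by
  let φ : MonoidAlgebra ℚ N →ₐ[ℚ] R := MonoidAlgebra.lift ℚ R N ψ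
  obtain ⟨M, hM, hle⟩ := Ideal.exists_le_maximal _ (RingHom.ker_ne_top φ.toRingHom)
  let θ : N →* MonoidAlgebra ℚ N ⧸ M :=
    (Ideal.Quotient.mk M : _ →* _).comp (MonoidAlgebra.of ℚ N)
  have : IsDomain (MonoidAlgebra ℚ N ⧸ M) := Ideal.Quotient.isDomain M
  refine isCyclic_of_injective_ringHom θ ((injective_iff_map_eq_one θ).2 fun a ha => ?_)
  let L : Subgroup N := Subgroup.zpowers a
  by_contra hne
  have hL : L ≠ ⊥ := by simpa [L] using hne
  have := Fintype.ofFinite L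
  have hθ : ∀ l : L, θ l = 1 := by
    rintro ⟨l, hl⟩
    obtain ⟨i, rfl⟩ := Subgroup.mem_zpowers_iff.1 hl
    have : a ∈ θ.ker := ha
    exact zpow_mem this i
  have hmem : ∑ l : L, MonoidAlgebra.of ℚ N l ∈ M := by
    apply hle
    have := h L hL
    rw [finsum_eq_sum_of_fintype] at this
    rw [RingHom.mem_ker, map_sum, ← this]
    exact Finset.sum_congr rfl fun l _ => by simp [φ]
  have h0 : ∑ l : L, θ l = 0 := by
    rw [← Ideal.Quotient.eq_zero_iff_mem, map_sum] at hmem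
    exact hmem
  have hc : (Fintype.card L : ℚ) = 0 := by
    apply (algebraMap ℚ (MonoidAlgebra ℚ N ⧸ M)).injective
    rw [map_zero, map_natCast, ← h0, Finset.sum_congr rfl fun l _ => hθ l]
    simp
  exact Fintype.card_ne_zero (by exact_mod_cast hc)

/-- An idempotent matrix `e` factors through its row space. -/
theorem Matrix.exists_factorization_of_idempotent {m : ℕ} {F : Type*} [Field F]
    {e : Matrix (Fin m) (Fin m) F} (he : e * e = e) :
    ∃ (r : ℕ) (X : Matrix (Fin r) (Fin m) F) (Y : Matrix (Fin m) (Fin r) F),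
      Y * X = e ∧ X * Y = 1 := by
  let U := LinearMap.range e.vecMulLinear
  let b := Module.finBasis F U
  let u : Fin m → U := fun i => ⟨e i, Pi.single i 1, by simp; rfl⟩
  have hYX : (Matrix.of fun i j => b.repr (u i) j) * (Matrix.of fun j => (b j : Fin m → F)) = e := by
    ext i l
    have := congrFun (congrArg U.subtype (b.sum_repr (u i))) l
    simp only [map_sum, map_smul, Finset.sum_apply] at this
    exact this
  refine ⟨_, Matrix.of fun j => b j, Matrix.of fun i j => b.repr (u i) j, hYX, ?_⟩
  ext j l
  have h : ∑ i, (b j : Fin m → F) i • u i = b j := by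
    apply Subtype.ext
    obtain ⟨v, hv⟩ := (b j).2
    have : (b j : Fin m → F) ᵥ* e = b j := by
      rw [← hv]; simp [Matrix.vecMul_vecMul, he]
    refine Eq.trans ?_ this
    ext i
    simp [u, Matrix.vecMul, dotProduct]
  have := congrArg (fun x => b.repr x l) h
  simpa [Matrix.mul_apply, Matrix.one_apply, Finsupp.single_apply] using this

theorem Matrix.even_of_isUnit_of_transpose_eq_neg {r : ℕ} {A : Matrix (Fin r) (Fin r) ℚ}
    (hA : Aᵀ = -A) (hu : IsUnit A) : Even r := by
  by_contra hr
  have h := congrArg Matrix.det hA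
  rw [Matrix.det_transpose, Matrix.det_neg, Fintype.card_fin,
    (Nat.not_even_iff_odd.1 hr).neg_one_pow] at h
  have h0 := ((Matrix.isUnit_iff_isUnit_det A).1 hu).ne_zero
  apply h0
  linarith

/-- A complete system of orthogonal idempotents, permuted by `G`, conjugate to each other under
`G` and self-adjoint for the form, exhibits `G` as symplectic imprimitive. -/
theorem isSympImprimitive_of_idempotents {n : ℕ} (G : Subgroup (GL (Fin (2 * n)) ℚ))
    {B : Matrix (Fin (2 * n)) (Fin (2 * n)) ℚ} (hBs : Bᵀ = -B) (hBu : IsUnit B)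
    (hB : ∀ g ∈ G, g.val * B * g.valᵀ = B)
    {e : Matrix (Fin (2 * n)) (Fin (2 * n)) ℚ} (he : e * e = e) (heB : e * B = B * eᵀ)
    {k : ℕ} (hk : 2 ≤ k) (γ : Fin k → GL (Fin (2 * n)) ℚ) (hγ : ∀ i, γ i ∈ G)
    (f : Fin k → Matrix (Fin (2 * n)) (Fin (2 * n)) ℚ)
    (hf : ∀ i, (γ i).val * f i = e * γ i)
    (hinj : Function.Injective f) (horth : ∀ i j, i ≠ j → f i * f j = 0)
    (hsum : ∑ i, f i = 1)
    (hconj : ∀ g ∈ G, ∀ i, ∃ j, g.val * f j = f i * g) :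
    IsSympImprimitive G := by
  obtain ⟨r, X, Y, hYX, hXY⟩ := Matrix.exists_factorization_of_idempotent he
  have hXe : X * e = X := by rw [← hYX, ← Matrix.mul_assoc, hXY, Matrix.one_mul]
  have heY : e * Y = Y := by rw [← hYX, Matrix.mul_assoc, hXY, Matrix.mul_one]
  have hf' : ∀ i, f i * (γ i)⁻¹.val = (γ i)⁻¹.val * e := by
    intro i
    rw [Units.mul_inv_eq_iff_eq_mul, mul_assoc, ← hf i, Units.inv_mul_cancel_left]
  -- the form on the row space of `e`
  have hAs : (X * B * Xᵀ)ᵀ = -(X * B * Xᵀ) := by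
    simp [Matrix.transpose_mul, hBs, Matrix.mul_assoc]
  obtain ⟨b, rfl⟩ := hBu
  have hAinv : X * b.val * Xᵀ * (Yᵀ * b⁻¹.val * Y) = 1 := by
    calc _ = X * (b.val * (Y * X)ᵀ) * b⁻¹.val * Y := by
          rw [Matrix.transpose_mul]; simp only [Matrix.mul_assoc]
      _ = 1 := by
          rw [hYX, ← heB, Matrix.mul_assoc, Matrix.mul_assoc, Matrix.mul_assoc,
            ← Matrix.mul_assoc b.val, ← Units.val_mul,
            mul_inv_cancel, Units.val_one, Matrix.one_mul, heY, hXY]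
  have hAu := IsUnit.of_mul_eq_one _ hAinv
  obtain ⟨d, hd⟩ := Matrix.even_of_isUnit_of_transpose_eq_neg hAs hAu
  obtain rfl : r = 2 * d := by omega
  clear hd
  -- the change of basis
  let T : Matrix (Fin k × Fin (2 * d)) (Fin (2 * n)) ℚ :=
    Matrix.of fun p l => (X * (γ p.1).val) p.2 l
  let S : Matrix (Fin (2 * n)) (Fin k × Fin (2 * d)) ℚ :=
    Matrix.of fun l p => ((γ p.1)⁻¹.val * Y) l p.2
  have hTMS : ∀ (M : Matrix (Fin (2 * n)) (Fin (2 * n)) ℚ) p q, (T * M * S) p q =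
      (X * (γ p.1).val * M * ((γ q.1)⁻¹.val * Y)) p.2 q.2 := fun _ _ _ => rfl
  have hblock : ∀ (M : Matrix (Fin (2 * n)) (Fin (2 * n)) ℚ) i j,
      X * (γ i).val * M * ((γ j)⁻¹.val * Y) =
        X * (γ i).val * (f i * M * f j) * ((γ j)⁻¹.val * Y) := by
    intro M i j
    calc _ = X * e * (γ i).val * M *
          ((γ j)⁻¹.val * (e * Y)) := by rw [hXe, heY]
      _ = X * (e * (γ i).val) * M *
          (((γ j)⁻¹.val * e) * Y) := by simp only [Matrix.mul_assoc]
      _ = _ := by rw [← hf, ← hf']; simp only [Matrix.mul_assoc]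
  have hTS : T * S = 1 := by
    rw [← Matrix.mul_one T]
    refine Matrix.ext fun p q => ?_
    obtain ⟨i, a⟩ := p
    obtain ⟨j, c⟩ := q
    rw [hTMS]
    rcases eq_or_ne i j with rfl | hij
    · have : X * (γ i).val * (1 : Matrix (Fin (2 * n)) (Fin (2 * n)) ℚ) *
          ((γ i)⁻¹.val * Y) = 1 := by
        rw [Matrix.mul_one, Matrix.mul_assoc, ← Matrix.mul_assoc _ _ Y, ← Units.val_mul,
          mul_inv_cancel, Units.val_one, Matrix.one_mul, hXY]
      simp only [this, Matrix.one_apply, Prod.mk.injEq, true_and]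
    · rw [hblock, mul_one, horth i j hij]
      simp [hij]
  have hST : S * T = 1 := by
    rw [← hsum]
    have h : ∀ i, f i = (γ i)⁻¹.val * Y * (X * (γ i).val) := fun i => by
      rw [Matrix.mul_assoc, ← Matrix.mul_assoc Y, hYX, ← hf, Units.inv_mul_cancel_left]
    ext l l'
    rw [Matrix.sum_apply, Matrix.mul_apply, Fintype.sum_prod_type]
    refine Finset.sum_congr rfl fun i _ => ?_
    rw [h i, Matrix.mul_apply]
    rfl
  have hcard : k * (2 * d) = 2 * n := by
    have := Matrix.square_of_invertible T S hTS hST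
    simpa using this
  let E : Fin k × Fin (2 * d) ≃ Fin (2 * n) := Fintype.equivOfCardEq (by simpa using hcard)
  let U : GL (Fin (2 * n)) ℚ :=
    { val := T.submatrix E.symm id
      inv := S.submatrix id E.symm
      val_inv := by
        rw [← Matrix.submatrix_mul T S E.symm id E.symm Function.bijective_id, hTS,
          Matrix.submatrix_one_equiv]
      inv_val := by
        rw [Matrix.submatrix_mul_equiv, hST, Matrix.submatrix_id_id] }
  refine ⟨d, k, by linarith, hk, E, X * b.val * Xᵀ, U,
    hAs, hAu, fun g hg => ?_⟩
  choose σ hσ using hconj g hg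
  have hσinj : Function.Injective σ := by
    intro i j hij
    apply hinj
    have := (hσ i).symm.trans ((congrArg (fun x => g.val * f x) hij).trans (hσ j))
    exact g.isUnit.mul_left_injective this
  refine ⟨Equiv.ofBijective σ (Finite.injective_iff_bijective.1 hσinj),
    fun i => X * (γ i * g * (γ (σ i))⁻¹).val * Y, fun i => ?_, ?_⟩
  · set u := γ i * g * (γ (σ i))⁻¹ with hu
    have huG : u ∈ G := G.mul_mem (G.mul_mem (hγ i) hg) (G.inv_mem (hγ _))
    have hue : u.val * e = e * u := by
      rw [hu, Units.val_mul, Units.val_mul, mul_assoc, ← hf', mul_assoc, ← mul_assoc _ (f _),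
        hσ, ← mul_assoc, ← mul_assoc, hf]
      simp only [mul_assoc]
    set v := u.val
    set c := b.val
    change X * v * Y * (X * c * Xᵀ) * (X * v * Y)ᵀ = _
    calc _ = X * v * ((Y * X) * c * (Y * X)ᵀ) * vᵀ * Xᵀ := by
          simp only [Matrix.transpose_mul, Matrix.mul_assoc]
      _ = X * (v * e) * c * vᵀ * Xᵀ := by
          rw [hYX, mul_assoc e, ← heB, ← mul_assoc e e, he]; simp only [Matrix.mul_assoc]
      _ = (X * e) * (v * c * vᵀ) * Xᵀ := by rw [hue]; simp only [Matrix.mul_assoc]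
      _ = _ := by rw [hXe, hB u huG]
  · have hU : (U * g * U⁻¹).val = Matrix.reindex E E (T * g.val * S) := rfl
    rw [hU]
    congr 1
    refine Matrix.ext fun ⟨i, a⟩ ⟨j, c⟩ => ?_
    rw [hTMS]
    simp only [Matrix.of_apply, Equiv.ofBijective_apply]
    split_ifs with hij
    · subst hij
      simp only [Units.val_mul, Matrix.mul_assoc]
    · rw [hblock, ← hσ, mul_assoc, horth _ _ hij]
      simp

/-- For a primitive irreducible symplectic group, a nonzero self-adjoint idempotent whose
conjugates are either equal or orthogonal to it is the identity. -/
theorem eq_one_of_orthogonal_conjugates {n : ℕ} (G : Subgroup (GL (Fin (2 * n)) ℚ))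
    (hfin : (G : Set (GL (Fin (2 * n)) ℚ)).Finite) (hirr : IsRatIrreducible G)
    (hprim : ¬ IsSympImprimitive G)
    {B : Matrix (Fin (2 * n)) (Fin (2 * n)) ℚ} (hBs : Bᵀ = -B) (hBu : IsUnit B)
    (hB : ∀ g ∈ G, g.val * B * g.valᵀ = B)
    {e : Matrix (Fin (2 * n)) (Fin (2 * n)) ℚ} (he0 : e ≠ 0) (he : e * e = e)
    (heB : e * B = B * eᵀ)
    (horth : ∀ g ∈ G, e * (g.val * e) = 0 ∨ g.val * e = e * g.val) : e = 1 := by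
  classical
  let O := hfin.toFinset.image fun g => g⁻¹.val * e * g.val
  let f : Fin O.card → Matrix (Fin (2 * n)) (Fin (2 * n)) ℚ := fun i => O.equivFin.symm i
  have hinj : Function.Injective f := Subtype.val_injective.comp O.equivFin.symm.injective
  have hmem : ∀ i, ∃ g ∈ G, g.val * f i = e * g.val := fun i => by
    obtain ⟨g, hg, h⟩ := Finset.mem_image.1 (O.equivFin.symm i).2
    refine ⟨g, hfin.mem_toFinset.1 hg, ?_⟩
    change g.val * (O.equivFin.symm i).1 = _
    rw [← h, mul_assoc, Units.mul_inv_cancel_left]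
  choose γ hγ hf using hmem
  have hf' : ∀ i, f i = (γ i)⁻¹.val * e * (γ i).val := fun i => by
    rw [mul_assoc, ← hf, Units.inv_mul_cancel_left]
  have hsurj : ∀ g ∈ G, ∃ j, g.val * f j = e * g.val := fun g hg => by
    refine ⟨O.equivFin ⟨g⁻¹.val * e * g.val,
      Finset.mem_image_of_mem _ (hfin.mem_toFinset.2 hg)⟩, ?_⟩
    simp only [f, Equiv.symm_apply_apply]
    rw [mul_assoc, Units.mul_inv_cancel_left]
  have hconj : ∀ g ∈ G, ∀ i, ∃ j, g.val * f j = f i * g := fun g hg i => by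
    obtain ⟨j, hj⟩ := hsurj (γ i * g) (G.mul_mem (hγ i) hg)
    refine ⟨j, (γ i).isUnit.mul_right_injective ?_⟩
    change (γ i).val * (g.val * f j) = (γ i).val * (f i * g.val)
    rw [← mul_assoc, ← Units.val_mul, hj, ← mul_assoc, hf, Units.val_mul, mul_assoc]
  have hidem : ∀ i, f i * f i = f i := fun i => by
    have : f i * f i = (γ i)⁻¹.val * (e * ((γ i).val * f i)) := by
      rw [hf]; nth_rw 1 [hf' i]; simp only [mul_assoc, hf]
    rw [this, hf, ← mul_assoc e, he, ← mul_assoc, ← hf']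
  have hfo : ∀ i j, i ≠ j → f i * f j = 0 := fun i j hij => by
    set u := γ i * (γ j)⁻¹ with hu
    have hui : u.val * (γ j).val = (γ i).val := by rw [← Units.val_mul]; simp [hu]
    have hiu : (γ j)⁻¹.val = (γ i)⁻¹.val * u.val := by rw [← Units.val_mul]; simp [hu]
    have hprod : f i * f j = (γ i)⁻¹.val * (e * (u.val * e)) * (γ j).val := by
      rw [hf', hf', hu, Units.val_mul]; simp only [mul_assoc]
    rcases horth u (G.mul_mem (hγ i) (G.inv_mem (hγ j))) with h | h
    · rw [hprod, h, mul_zero, zero_mul]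
    · refine absurd (hinj ?_) hij
      rw [hf', hf' j, hiu, mul_assoc _ u.val, h, mul_assoc, mul_assoc, mul_assoc, hui]
  obtain ⟨i₀, hi₀⟩ := hsurj 1 G.one_mem
  rw [Units.val_one, one_mul, mul_one] at hi₀
  set s := ∑ i, f i with hs
  have hfs : ∀ i, f i * s = f i := fun i => by
    rw [hs, Finset.mul_sum, Finset.sum_eq_single i (fun j _ hj => hfo i j hj.symm) (by simp),
      hidem]
  have hss : s * s = s := by
    conv_lhs => enter [1]; rw [hs]
    rw [Finset.sum_mul, Finset.sum_congr rfl fun i _ => hfs i]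
  have hinv : IsInvariantSubspace G (LinearMap.range s.vecMulLinear) := by
    rintro g hg _ ⟨v, rfl⟩
    choose σ hσ using hconj g hg
    have hσinj : Function.Injective σ := by
      intro i j hij
      apply hinj
      have := (hσ i).symm.trans ((congrArg (fun x => g.val * f x) hij).trans (hσ j))
      exact g.isUnit.mul_left_injective this
    have hcomm : s * g.val = g.val * s := by
      rw [hs, Finset.sum_mul, Finset.mul_sum, ← Finset.sum_congr rfl fun i _ => hσ i]
      exact (Equiv.ofBijective σ (Finite.injective_iff_bijective.1 hσinj)).sum_comp
        fun i => g.val * f i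
    refine ⟨v ᵥ* g.val, ?_⟩
    simp [Matrix.vecMul_vecMul, hcomm]
  have hs1 : s = 1 := by
    rcases hirr _ hinv with h | h
    · refine absurd ?_ he0
      have : s = 0 := by
        ext i j
        have hz : s.vecMulLinear (Pi.single i 1) = 0 := by
          rw [LinearMap.range_eq_bot.1 h, LinearMap.zero_apply]
        simpa using congrFun hz j
      rw [← hi₀, ← hfs, this, mul_zero]
    · have hu : IsUnit s := Matrix.vecMul_surjective_iff_isUnit.1 (LinearMap.range_eq_top.1 h)
      exact hu.mul_left_cancel (by rw [hss, mul_one])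
  have hk : ¬ 2 ≤ O.card := fun hk => hprim <|
    isSympImprimitive_of_idempotents G hBs hBu hB he heB hk γ hγ f hf hinj hfo hs1 hconj
  have : Subsingleton (Fin O.card) := Fin.subsingleton_iff_le_one.2 (by omega)
  rw [← hi₀, ← hs1, hs, Fintype.sum_subsingleton _ i₀]

/-- A normal abelian subgroup of a finite primitive irreducible symplectic group is cyclic. -/
theorem isCyclic_of_normal_of_not_isSympImprimitive {n : ℕ} (G : Subgroup (GL (Fin (2 * n)) ℚ))
    (hfin : (G : Set (GL (Fin (2 * n)) ℚ)).Finite) (hirr : IsRatIrreducible G)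
    (hsymp : IsSymplecticGroup G) (hprim : ¬ IsSympImprimitive G)
    (N : Subgroup (GL (Fin (2 * n)) ℚ)) (hNG : N ≤ G)
    (hN : ∀ g ∈ G, ∀ a ∈ N, g * a * g⁻¹ ∈ N) (hab : ∀ a ∈ N, ∀ b ∈ N, a * b = b * a) :
    IsCyclic N := by
  obtain ⟨B, hBs, hBu, hB⟩ := hsymp
  have : Finite G := hfin
  have : Finite N := Finite.of_injective _ (Subgroup.inclusion_injective hNG)
  rcases n.eq_zero_or_pos with rfl | hn
  · have : Subsingleton (GL (Fin (2 * 0)) ℚ) := ⟨fun a b => Units.ext (by ext i; exact i.elim0)⟩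
    infer_instance
  have : NeZero (2 * n) := ⟨by omega⟩
  have hsub : ∀ K ≤ N, Finite K := fun K hK =>
    Finite.of_injective _ (Subgroup.inclusion_injective hK)
  have hNfin : {K : Subgroup (GL (Fin (2 * n)) ℚ) | K ≤ N}.Finite :=
    Set.Finite.of_finite_image (f := SetLike.coe)
      ((Set.toFinite (N : Set (GL (Fin (2 * n)) ℚ))).finite_subsets.subset
        (by rintro _ ⟨K, hK, rfl⟩; exact hK)) SetLike.coe_injective.injOn
  have hfin' : {K : Subgroup (GL (Fin (2 * n)) ℚ) | K ≤ N ∧ K.average ≠ 0}.Finite :=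
    hNfin.subset fun K h => h.1
  obtain ⟨K, hK⟩ := hfin'.exists_maximal
    ⟨⊥, bot_le, by rw [Subgroup.average_bot]; exact one_ne_zero⟩
  have hKN : K ≤ N := hK.prop.1
  have := hsub K hKN
  have hcomm : ∀ L ≤ N, ∀ M ≤ N, Commute L.average M.average := fun L hL M hM => by
    have := hsub L hL
    have := hsub M hM
    exact M.commute_average fun b hb => (L.commute_average fun a ha => by
      exact congrArg Units.val (hab b (hM hb) a (hL ha))).symm
  have he1 : K.average = 1 := by
    refine eq_one_of_orthogonal_conjugates G hfin hirr hprim hBs hBu hB hK.prop.2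
      K.average_mul_self (K.average_mul_form fun g hg => hB g (hNG (hKN hg))) fun g hg => ?_
    set L := K.map (MulAut.conj g).toMonoidHom with hLdef
    have hLN : L ≤ N := by
      rintro _ ⟨a, ha, rfl⟩
      exact hN g hg a (hKN ha)
    have := hsub L hLN
    have := hsub (K ⊔ L) (sup_le hKN hLN)
    have hL : g.val * K.average = L.average * g.val := by
      rw [← K.conj_average, Units.inv_mul_cancel_right]
    by_cases h0 : (K ⊔ L).average = 0
    · left
      have hfix : ∀ a ∈ K ⊔ L, K.average * L.average * a.val = K.average * L.average := by
        let S : Subgroup (GL (Fin (2 * n)) ℚ) :=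
          { carrier := {a | K.average * L.average * a.val = K.average * L.average}
            mul_mem' := fun {a b} ha hb => by
              simp only [Set.mem_ofPred_eq] at *
              rw [Units.val_mul, ← mul_assoc, ha, hb]
            one_mem' := by simp
            inv_mem' := fun {a} ha => by
              simp only [Set.mem_ofPred_eq] at *
              rw [Units.mul_inv_eq_iff_eq_mul, ha] }
        refine fun a ha => (sup_le ?_ ?_ : K ⊔ L ≤ S) ha
        · intro a ha
          change K.average * L.average * a.val = K.average * L.average
          rw [(hcomm K hKN L hLN).eq, mul_assoc, K.average_mul_of_mem ha]
        · intro a ha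
          change K.average * L.average * a.val = K.average * L.average
          rw [mul_assoc, L.average_mul_of_mem ha]
      rw [hL, ← mul_assoc, ← (K ⊔ L).mul_average_of_forall_mul_eq hfix, h0, mul_zero, zero_mul]
    · right
      have hle : L ≤ K := le_sup_right.trans (hK.le_of_ge ⟨sup_le hKN hLN, h0⟩ le_sup_left)
      have hLK : L = K := Subgroup.eq_of_le_of_card_ge hle
        (Nat.card_congr (K.equivMapOfInjective (MulAut.conj g).toMonoidHom
          (MulAut.conj g).injective).toEquiv).le
      rw [hL, hLK]
  have hKbot : K = ⊥ := (Subgroup.eq_bot_iff_forall K).2 fun a ha => Units.ext <| by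
    simpa [he1] using K.average_mul_of_mem ha
  let _ : CommGroup N := { (inferInstance : Group N) with
    mul_comm := fun a b => Subtype.ext (hab a a.2 b b.2) }
  refine isCyclic_of_sum_subgroup_eq_zero
    ((Units.coeHom (Matrix (Fin (2 * n)) (Fin (2 * n)) ℚ)).comp N.subtype) fun L hL => ?_
  have hM : (L.map N.subtype).average = 0 := by
    by_contra h0
    have hle := hK.le_of_ge ⟨Subgroup.map_subtype_le L, h0⟩ (by rw [hKbot]; exact bot_le)
    rw [hKbot, le_bot_iff, Subgroup.map_eq_bot_iff_of_injective _ N.subtype_injective] at hle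
    exact hL hle
  have hfinM := hsub _ (Subgroup.map_subtype_le L)
  have hc : (Nat.card (L.map N.subtype) : ℚ)⁻¹ ≠ 0 :=
    inv_ne_zero (by exact_mod_cast Nat.card_pos.ne')
  rw [← (smul_eq_zero.1 hM).resolve_left hc]
  exact finsum_eq_of_bijective (L.equivMapOfInjective N.subtype N.subtype_injective)
    (MulEquiv.bijective _) fun _ => rfl

/-- If `G ≤ GL_{2n}(ℚ)` is finite, rationally irreducible, symplectic and symplectic
primitive, `P ⊴ G` is a normal `p`-subgroup and `A` is an abelian characteristic
subgroup of `P`, then `A` is cyclic. -/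
theorem sympPrimitive_abelian_char_subgroup_cyclic {n p : ℕ} (hp : p.Prime)
    (G : Subgroup (GL (Fin (2 * n)) ℚ))
    (hfin : (G : Set (GL (Fin (2 * n)) ℚ)).Finite)
    (hirr : IsRatIrreducible G)
    (hsymp : IsSymplecticGroup G)
    (hprim : ¬ IsSympImprimitive G)
    (P : Subgroup G) (hPnormal : P.Normal) (hPp : IsPGroup p P)
    (A : Subgroup P) (hAchar : A.Characteristic)
    (hAab : ∀ a b : A, a * b = b * a) :
    IsCyclic A := by
  have hnorm : (A.map P.subtype).Normal := inferInstance
  let ι : A →* GL (Fin (2 * n)) ℚ := (G.subtype.comp P.subtype).comp A.subtype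
  have hι : Function.Injective ι :=
    (G.subtype_injective.comp P.subtype_injective).comp A.subtype_injective
  have hcyc : IsCyclic ι.range := by
    refine isCyclic_of_normal_of_not_isSympImprimitive G hfin hirr hsymp hprim _ ?_ ?_ ?_
    · rintro _ ⟨a, rfl⟩
      exact (a : P).1.2
    · rintro g hg _ ⟨a, rfl⟩
      obtain ⟨b, hb, h⟩ := hnorm.conj_mem (a : P) ⟨a, a.2, rfl⟩ ⟨g, hg⟩
      exact ⟨⟨b, hb⟩, congrArg Subtype.val h⟩
    · rintro _ ⟨a, rfl⟩ _ ⟨b, rfl⟩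
      rw [← map_mul, hAab, map_mul]
  exact (MonoidHom.ofInjective hι).isCyclic.2 hcyc
end

section
/- (Minkowski's bound) Let n ≥ 1 and let G be a finite subgroup of GL_n(ℚ). Then the order of G divides ∏_p p^{e_p(n)}, where the product runs over all primes p ≤ n + 1 and e_p(n) = ⌊n/(p−1)⌋ + ⌊n/(p(p−1))⌋ + ⌊n/(p²(p−1))⌋ + ⋯ = Σ_{i≥0} ⌊n/(p^i(p−1))⌋ (a finite sum). -/
open Matrix
open scoped MatrixGroups

open Polynomial in
/-- The sum of the roots of a cyclotomic polynomial of level a power of `p` differs from its degree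
`d` by a multiple `p * m` with `(p - 1) * m ≤ d`, and `m = 0` happens only for `X - 1`. -/
theorem nextCoeff_cyclotomic_prime_pow {p : ℕ} (hp : p.Prime) (i : ℕ) :
    ∃ m : ℕ, (p - 1) * m ≤ (cyclotomic (p ^ i) ℚ).natDegree ∧
      (cyclotomic (p ^ i) ℚ).nextCoeff = p * m - (cyclotomic (p ^ i) ℚ).natDegree ∧
      (m = 0 → cyclotomic (p ^ i) ℚ = (X - 1) ^ (cyclotomic (p ^ i) ℚ).natDegree) := by
  have := Fact.mk hp
  have hp2 := hp.two_le
  rcases i with _ | _ | i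
  · refine ⟨0, by simp, ?_, fun _ => ?_⟩
    · have h : (X - 1 : ℚ[X]) = X - C 1 := by simp
      rw [pow_zero, cyclotomic_one, h, nextCoeff_X_sub_C, natDegree_X_sub_C]
      simp
    · have h : (X - 1 : ℚ[X]).natDegree = 1 := by
        simpa using natDegree_X_sub_C (1 : ℚ)
      rw [pow_zero, cyclotomic_one, h, pow_one]
  · have hd : (cyclotomic (p ^ (0 + 1)) ℚ).natDegree = p - 1 := by
      rw [natDegree_cyclotomic, zero_add, pow_one, Nat.totient_prime hp]
    refine ⟨1, by rw [hd, mul_one], ?_, by simp⟩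
    rw [nextCoeff_of_natDegree_pos (by omega), hd, zero_add, pow_one, cyclotomic_prime,
      finsetSum_coeff]
    simp only [coeff_X_pow]
    rw [Finset.sum_ite_eq, if_pos (Finset.mem_range.2 (by omega)), Nat.cast_sub (by omega)]
    simp
  · have hd : (cyclotomic (p ^ (i + 1 + 1)) ℚ).natDegree = p ^ (i + 1) * (p - 1) := by
      rw [natDegree_cyclotomic, Nat.totient_prime_pow_succ hp]
    have hpos : 0 < p ^ i * (p - 1) := Nat.mul_pos (pow_pos hp.pos i) (by omega)
    refine ⟨p ^ i * (p - 1), ?_, ?_, fun h => by omega⟩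
    · rw [hd, mul_comm, pow_succ]
      gcongr ?_ * _
      gcongr
      omega
    · have hz : (cyclotomic (p ^ (i + 1 + 1)) ℚ).nextCoeff = 0 := by
        have hpos' : 0 < p ^ (i + 1) * (p - 1) := Nat.mul_pos (pow_pos hp.pos _) (by omega)
        rw [nextCoeff_of_natDegree_pos (by omega), hd, pow_succ p (i + 1),
          ← cyclotomic_expand_eq_cyclotomic hp (dvd_pow_self p i.succ_ne_zero) ℚ,
          coeff_expand hp.pos, if_neg]
        intro h
        have h1 : p ∣ p ^ (i + 1) * (p - 1) := (dvd_pow_self p i.succ_ne_zero).mul_right _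
        have h2 := (Nat.dvd_sub h1 h)
        rw [Nat.sub_sub_self hpos'] at h2
        exact hp.one_lt.ne' (Nat.dvd_one.1 h2)
      rw [hz, hd]
      push_cast
      ring

open Polynomial in
/-- The sum of the roots of a product of cyclotomic polynomials of level a power of `p` differs from
its degree `d` by a multiple `p * m` with `(p - 1) * m ≤ d`, and `m = 0` happens only for a power
of `X - 1`. -/
theorem nextCoeff_multiset_prod_cyclotomic_prime_pow {p : ℕ} (hp : p.Prime)
    (s : Multiset ℚ[X]) (hs : ∀ q ∈ s, ∃ i : ℕ, q = cyclotomic (p ^ i) ℚ) :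
    ∃ m : ℕ, (p - 1) * m ≤ s.prod.natDegree ∧
      s.prod.nextCoeff = p * m - s.prod.natDegree ∧
      (m = 0 → s.prod = (X - 1) ^ s.prod.natDegree) := by
  induction s using Multiset.induction with
  | empty => exact ⟨0, by simp [nextCoeff]⟩
  | cons q s ih =>
    obtain ⟨m, h1, h2, h3⟩ := ih fun r hr => hs r (Multiset.mem_cons_of_mem hr)
    obtain ⟨i, rfl⟩ := hs q (Multiset.mem_cons_self q s)
    obtain ⟨m', h1', h2', h3'⟩ := nextCoeff_cyclotomic_prime_pow hp i
    have hm : s.prod.Monic := by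
      rw [← Multiset.map_id s]
      refine monic_multiset_prod_of_monic s id fun r hr => ?_
      obtain ⟨j, rfl⟩ := hs r (Multiset.mem_cons_of_mem hr)
      exact cyclotomic.monic _ _
    have hc : (cyclotomic (p ^ i) ℚ).Monic := cyclotomic.monic _ _
    rw [Multiset.prod_cons, hc.natDegree_mul hm, hc.nextCoeff_mul hm, h2, h2']
    refine ⟨m' + m, by rw [mul_add]; exact add_le_add h1' h1, by push_cast; ring, fun h => ?_⟩
    rw [pow_add, ← h3' (by omega), ← h3 (by omega)]

open Polynomial in
/-- A monic irreducible factor of the characteristic polynomial of a rational matrix of finite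
order dividing `N` is a cyclotomic polynomial of level dividing `N`. -/
theorem exists_eq_cyclotomic_of_dvd_charpoly {m : Type*} [Fintype m] [DecidableEq m]
    {A : Matrix m m ℚ} {N : ℕ} (hN : N ≠ 0) (hA : A ^ N = 1) {q : ℚ[X]} (hq : q.Monic)
    (hirr : Irreducible q) (hdvd : q ∣ A.charpoly) :
    ∃ d, d ∣ N ∧ q = cyclotomic d ℚ := by
  have := Fact.mk hirr
  set K := AdjoinRoot q
  let α : K := AdjoinRoot.root q
  let B : Matrix m m K := A.map (algebraMap ℚ K)
  have hα0 : aeval α q = 0 := by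
    rw [aeval_def, Subsingleton.elim (algebraMap ℚ K) (AdjoinRoot.of q)]
    exact AdjoinRoot.eval₂_root q
  have hroot : B.charpoly.IsRoot α := by
    rw [show B.charpoly = A.charpoly.map (algebraMap ℚ K) from A.charpoly_map (algebraMap ℚ K),
      IsRoot, eval_map_algebraMap]
    obtain ⟨r, hr⟩ := hdvd
    rw [hr, map_mul]
    rw [hα0, zero_mul]
  have hB : B ^ N = 1 := by
    have : B = (algebraMap ℚ K).mapMatrix A := rfl
    rw [this, ← map_pow, hA, map_one]
  have hα : α ^ N = 1 := by
    have h := spectrum.pow_mem_pow B N (Matrix.mem_spectrum_of_isRoot_charpoly hroot)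
    rw [hB] at h
    have : Nontrivial (Matrix m m K) := by
      by_contra hcon
      rw [not_nontrivial_iff_subsingleton] at hcon
      exact absurd h (by rw [spectrum.of_subsingleton]; exact Set.notMem_empty _)
    simpa [spectrum.one_eq] using h
  refine ⟨orderOf α, orderOf_dvd_of_pow_eq_one hα, ?_⟩
  have hpos : 0 < orderOf α :=
    orderOf_pos_iff.2 (isOfFinOrder_iff_pow_eq_one.2 ⟨N, Nat.pos_of_ne_zero hN, hα⟩)
  rw [cyclotomic_eq_minpoly_rat (IsPrimitiveRoot.orderOf α) hpos]
  exact minpoly.eq_of_irreducible_of_monic hirr hα0 hq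

open Polynomial in
/-- The trace of a rational matrix of `p`-power order differs from that of the identity by
a multiple `p * m` with `m ≤ n / (p - 1)`, and `m = 0` happens only for the identity. -/
theorem Matrix.exists_trace_eq_of_pow_prime_pow_eq_one {n p k : ℕ} (hp : p.Prime)
    {A : Matrix (Fin n) (Fin n) ℚ} (hA : A ^ p ^ k = 1) :
    ∃ m : ℕ, m ≤ n / (p - 1) ∧ A.trace = n - p * m ∧ (m = 0 → A = 1) := by
  have hpk : p ^ k ≠ 0 := (pow_pos hp.pos k).ne'
  have hmon := A.charpoly_monic
  have hprod : (UniqueFactorizationMonoid.normalizedFactors A.charpoly).prod = A.charpoly := by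
    rw [UniqueFactorizationMonoid.prod_normalizedFactors_eq hmon.ne_zero, hmon.normalize_eq_self]
  have hfac : ∀ q ∈ UniqueFactorizationMonoid.normalizedFactors A.charpoly,
      ∃ i : ℕ, q = cyclotomic (p ^ i) ℚ := by
    intro q hq
    have hirr := UniqueFactorizationMonoid.irreducible_of_normalized_factor q hq
    have hqm : q.Monic := by
      rw [← UniqueFactorizationMonoid.normalize_normalized_factor q hq]
      exact monic_normalize hirr.ne_zero
    obtain ⟨d, hd, rfl⟩ := exists_eq_cyclotomic_of_dvd_charpoly hpk hA hqm hirr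
      (UniqueFactorizationMonoid.dvd_of_mem_normalizedFactors hq)
    obtain ⟨i, -, rfl⟩ := (Nat.dvd_prime_pow hp).1 hd
    exact ⟨i, rfl⟩
  obtain ⟨m, h1, h2, h3⟩ := nextCoeff_multiset_prod_cyclotomic_prime_pow hp _ hfac
  rw [hprod, Matrix.charpoly_natDegree_eq_dim, Fintype.card_fin] at h1 h2 h3
  have hp1 : 0 < p - 1 := Nat.sub_pos_of_lt hp.one_lt
  refine ⟨m, (Nat.le_div_iff_mul_le hp1).2 (by rwa [mul_comm]), ?_, fun hm => ?_⟩
  · rw [Matrix.trace_eq_neg_charpoly_nextCoeff, h2]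
    ring
  · have hsq : Squarefree (minpoly ℚ A) := by
      refine Squarefree.squarefree_of_dvd (minpoly.dvd ℚ A (p := X ^ p ^ k - C 1) ?_)
        (separable_X_pow_sub_C (1 : ℚ) (by exact_mod_cast hpk) one_ne_zero).squarefree
      simp [hA]
    rcases eq_or_ne n 0 with rfl | hn
    · exact Subsingleton.elim _ _
    · have hd : minpoly ℚ A ∣ (X - 1) ^ n := by
        rw [← h3 hm]
        exact Matrix.minpoly_dvd_charpoly A
      obtain ⟨r, hr⟩ := (hsq.dvd_pow_iff_dvd hn).1 hd
      have := congrArg (aeval A) hr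
      rw [map_mul, minpoly.aeval, zero_mul] at this
      simpa [sub_eq_zero] using this

/-- Sums of products of rational characters over a finite group are integer multiples of the
order of the group. -/
theorem Representation.exists_sum_char_mul_char_pow_eq {G : Type*} [Group G] [Fintype G]
    {V : Type} [AddCommGroup V] [Module ℚ V] [FiniteDimensional ℚ V]
    (ρ : Representation ℚ G V) (k : ℕ) {W : Type} [AddCommGroup W] [Module ℚ W]
    [FiniteDimensional ℚ W] (σ : Representation ℚ G W) :
    ∃ z : ℤ, ∑ g : G, σ.character g * ρ.character g ^ k = Nat.card G * z := by
  induction k generalizing W with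
  | zero =>
    have hc : (Nat.card G : ℚ) ≠ 0 := by exact_mod_cast Nat.card_pos.ne'
    let _ := invertibleOfNonzero hc
    have h := σ.card_inv_mul_sum_char_eq_finrank
    refine ⟨Module.finrank ℚ σ.invariants, ?_⟩
    rw [inv_mul_eq_iff_eq_mul₀ hc] at h
    simpa using h
  | succ k ih =>
    obtain ⟨z, hz⟩ := ih (σ.tprod ρ)
    refine ⟨z, hz ▸ Finset.sum_congr rfl fun g _ => ?_⟩
    rw [Representation.char_tensor, Pi.mul_apply, pow_succ']
    ring

open Polynomial in
/-- Summing an integer polynomial in a rational character over a finite group gives an integer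
multiple of the order of the group. -/
theorem Representation.exists_sum_aeval_char_eq {G : Type*} [Group G] [Fintype G]
    {V : Type} [AddCommGroup V] [Module ℚ V] [FiniteDimensional ℚ V]
    (ρ : Representation ℚ G V) (F : ℤ[X]) :
    ∃ z : ℤ, ∑ g : G, aeval (ρ.character g) F = Nat.card G * z := by
  induction F using Polynomial.induction_on' with
  | add P Q hP hQ =>
    obtain ⟨a, ha⟩ := hP
    obtain ⟨b, hb⟩ := hQ
    exact ⟨a + b, by simp only [map_add, Finset.sum_add_distrib, ha, hb]; push_cast; ring⟩
  | monomial k c =>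
    obtain ⟨z, hz⟩ := ρ.exists_sum_char_mul_char_pow_eq k (Representation.trivial ℚ G ℚ)
    refine ⟨c * z, ?_⟩
    have h1 : ∀ g : G, (Representation.trivial ℚ G ℚ).character g = 1 := fun g => by
      simp [Representation.character]
    simp only [h1, one_mul] at hz
    simp only [aeval_monomial, ← Finset.mul_sum, hz]
    simp only [algebraMap_int_eq, eq_intCast]
    push_cast
    ring

open Polynomial in
/-- Schur's divisibility: a finite `p`-group with a faithful rational representation of dimension
`n` has order dividing `p ^ N * N !`, where `N = n / (p - 1)`. -/
theorem IsPGroup.card_dvd_of_injective {n p : ℕ} (hp : p.Prime) {P : Type*} [Group P] [Finite P]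
    (hP : IsPGroup p P) (f : P →* Matrix (Fin n) (Fin n) ℚ) (hf : Function.Injective f) :
    Nat.card P ∣ p ^ (n / (p - 1)) * (n / (p - 1)).factorial := by
  have := Fintype.ofFinite P
  set N := n / (p - 1)
  let ρ : Representation ℚ P (Fin n → ℚ) :=
    (Matrix.toLinAlgEquiv' : Matrix (Fin n) (Fin n) ℚ ≃ₐ[ℚ] _).toMonoidHom.comp f
  have hρ : ∀ g, ρ.character g = (f g).trace := fun g => Matrix.trace_toLin'_eq (f g)
  let F : ℤ[X] := ∏ i ∈ Finset.range N, (X - C ((n : ℤ) - p * (i + 1 : ℕ)))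
  have hF : ∀ x : ℚ, aeval x F = ∏ i ∈ Finset.range N, (x - (n - p * (i + 1 : ℕ))) := fun x => by
    simp [F, map_prod]
  obtain ⟨z, hz⟩ := ρ.exists_sum_aeval_char_eq F
  have h1 : aeval (ρ.character 1) F = ((p ^ N * N.factorial : ℕ) : ℚ) := by
    rw [hF, hρ, map_one, Matrix.trace_one, Fintype.card_fin]
    simp only [sub_sub_cancel, Finset.prod_mul_distrib, Finset.prod_const, Finset.card_range]
    rw [← Finset.prod_range_add_one_eq_factorial]
    push_cast
    rfl
  rw [Finset.sum_eq_single_of_mem 1 (Finset.mem_univ _), h1] at hz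
  · have : ((p ^ N * N.factorial : ℕ) : ℤ) = Nat.card P * z := by exact_mod_cast hz
    exact Int.natCast_dvd_natCast.1 ⟨z, this⟩
  · intro g _ hg
    obtain ⟨k, hk⟩ := hP g
    obtain ⟨m, hm, htr, hone⟩ := Matrix.exists_trace_eq_of_pow_prime_pow_eq_one hp
      (A := f g) (k := k) (by rw [← map_pow, hk, map_one])
    have hm0 : m ≠ 0 := fun h => hg (hf (by rw [hone h, map_one]))
    rw [hF, hρ, htr]
    refine Finset.prod_eq_zero (Finset.mem_range.2 (show m - 1 < N by omega)) ?_
    rw [Nat.sub_add_cancel (Nat.pos_of_ne_zero hm0), sub_self]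

theorem Nat.factorization_pow_mul_factorial_div_pred {n p : ℕ} (hp : p.Prime) :
    (p ^ (n / (p - 1)) * (n / (p - 1)).factorial).factorization p =
      ∑ i ∈ Finset.range (n + 1), n / (p ^ i * (p - 1)) := by
  have := Fact.mk hp
  have hle : n / (p - 1) ≤ n := Nat.div_le_self _ _
  have hlog : Nat.log p (n / (p - 1)) < n + 1 :=
    Nat.lt_succ_of_le ((Nat.log_le_self _ _).trans hle)
  rw [Nat.factorization_mul (pow_pos hp.pos _).ne' (Nat.factorial_ne_zero _), Finsupp.add_apply,
    hp.factorization_pow, Finsupp.single_eq_same, Nat.factorization_def _ hp,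
    padicValNat_factorial hlog, Finset.range_eq_Ico,
    Finset.sum_eq_sum_Ico_succ_bot (Nat.succ_pos n)]
  simp only [pow_zero, one_mul, zero_add, Nat.div_div_eq_div_mul]
  exact congrArg _ (Finset.sum_congr rfl fun i _ => by rw [mul_comm])

theorem factorization_card_le_of_finite_subgroup {n p : ℕ} (hp : p.Prime)
    (G : Subgroup (GL (Fin n) ℚ)) [Finite G] :
    (Nat.card G).factorization p ≤ ∑ i ∈ Finset.range (n + 1), n / (p ^ i * (p - 1)) := by
  have := Fact.mk hp
  obtain ⟨P⟩ : Nonempty (Sylow p G) := inferInstance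
  have h := P.isPGroup'.card_dvd_of_injective hp
    ((Units.coeHom _).comp (G.subtype.comp (P : Subgroup G).subtype))
    (Units.val_injective.comp (Subtype.val_injective.comp Subtype.val_injective))
  rw [P.card_eq_multiplicity] at h
  rw [← Nat.factorization_pow_mul_factorial_div_pred hp]
  exact (hp.pow_dvd_iff_le_factorization
    (mul_ne_zero (pow_pos hp.pos _).ne' (Nat.factorial_ne_zero _))).1 h

/-- Minkowski's bound: the order of every finite subgroup of `GL_n(ℚ)` divides
`∏_{p ≤ n+1 prime} p^{Σ_{i ≥ 0} ⌊n / (pⁱ(p−1))⌋}` (the sum is finite; all terms with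
`i > n` vanish). -/
theorem minkowski_order_bound {n : ℕ} (hn : 1 ≤ n)
    (G : Subgroup (GL (Fin n) ℚ)) (hG : (G : Set (GL (Fin n) ℚ)).Finite) :
    Nat.card G ∣
      ∏ p ∈ (Finset.range (n + 2)).filter Nat.Prime,
        p ^ (∑ i ∈ Finset.range (n + 1), n / (p ^ i * (p - 1))) := by
  have : Finite G := hG
  refine (Nat.dvd_iff_prime_pow_dvd_dvd _ _).2 fun p k hp hk => ?_
  have hle : k ≤ ∑ i ∈ Finset.range (n + 1), n / (p ^ i * (p - 1)) :=
    ((hp.pow_dvd_iff_le_factorization Nat.card_pos.ne').1 hk).trans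
      (factorization_card_le_of_finite_subgroup hp G)
  by_cases hpn : p < n + 2
  · exact (pow_dvd_pow p hle).trans (Finset.dvd_prod_of_mem
      (fun p => p ^ (∑ i ∈ Finset.range (n + 1), n / (p ^ i * (p - 1))))
      (Finset.mem_filter.2 ⟨Finset.mem_range.2 hpn, hp⟩))
  · have hz : ∑ i ∈ Finset.range (n + 1), n / (p ^ i * (p - 1)) = 0 :=
      Finset.sum_eq_zero fun i _ => Nat.div_eq_of_lt <|
        (show n < p - 1 by omega).trans_le (Nat.le_mul_of_pos_left _ (pow_pos hp.pos i))
    rw [hz, Nat.le_zero] at hle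
    rw [hle, pow_zero]
    exact one_dvd _
end
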